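/- arXiv:2502.06532 — 7 statements merged into one kernel-verified Lean document; each statement's English description precedes it below -/
import Mathlib

section
/- Let r₀ > 0 and let f : ℂ → ℂ be continuously differentiable (in the real sense, i.e. of class C¹ over ℝ) on the punctured disc D* = {t ∈ ℂ : 0 < |t| < r₀}. Suppose there is a measurable function u : (0, r₀) → [0, ∞) such that ‖Df(t)‖ ≤ u(|t|) for every t ∈ D*, where Df(t) denotes the real Fréchet derivative of f at t, and such that ∫₀^{r₀} u(s) ds < ∞. Then f admits a finite limit at the origin: there exists L ∈ ℂ such that f(t) → L as t → 0 with t ≠ 0. -/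
open MeasureTheory Set Filter

/-- Since `s⁻¹` is not integrable at `0`, an integrable function `u` on `(0, δ)` satisfies
`s * u s < ε` for some `s`. -/
lemma exists_mul_lt_of_integrableOn_Ioo {u : ℝ → ℝ} {δ ε : ℝ} (hδ : 0 < δ) (hε : 0 < ε)
    (hu : IntegrableOn u (Ioo 0 δ)) : ∃ s ∈ Ioo 0 δ, s * u s < ε := by
  by_contra! h
  have hinv : IntegrableOn (fun s : ℝ => s⁻¹) (Ioo 0 δ) := by
    refine Integrable.mono' (hu.const_mul ε⁻¹) measurable_inv.aestronglyMeasurable ?_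
    refine (ae_restrict_iff' measurableSet_Ioo).2 (Eventually.of_forall fun s hs => ?_)
    rw [Real.norm_of_nonneg (inv_nonneg.2 hs.1.le), inv_mul_eq_div, le_div_iff₀ hε,
      inv_mul_le_iff₀ hs.1]
    exact h s hs
  rw [← intervalIntegrable_iff_integrableOn_Ioo_of_le hδ.le, intervalIntegrable_inv_iff] at hinv
  rcases hinv with h0 | h0
  · exact hδ.ne h0
  · exact h0 left_mem_uIcc

section RadialBound

variable {F : Type*} [NormedAddCommGroup F] [NormedSpace ℝ F] {f : ℂ → F} {u : ℝ → ℝ}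

/-- Mean value inequality along a ray from the origin. -/
lemma norm_sub_le_integral_of_fderiv_le_radial {a b : ℝ} {e : ℂ} (he : ‖e‖ = 1) (ha : 0 < a)
    (hab : a ≤ b) (hf : ∀ t : ℂ, ‖t‖ ∈ Icc a b → DifferentiableAt ℝ f t)
    (hbound : ∀ t : ℂ, ‖t‖ ∈ Icc a b → ‖fderiv ℝ f t‖ ≤ u ‖t‖)
    (hint : IntervalIntegrable u volume a b) :
    ‖f (b * e) - f (a * e)‖ ≤ ∫ s in a..b, u s := by
  have hnorm : ∀ s ∈ Icc a b, ‖(s : ℂ) * e‖ = s := fun s hs => by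
    simp [he, abs_of_pos (ha.trans_le hs.1)]
  have hmem : ∀ s ∈ Icc a b, ‖(s : ℂ) * e‖ ∈ Icc a b := fun s hs => by rwa [hnorm s hs]
  have hderiv : ∀ s ∈ Icc a b,
      HasDerivAt (fun x : ℝ => f (x * e)) (fderiv ℝ f (s * e) e) s := fun s hs => by
    have hray : HasDerivAt (fun x : ℝ => (x : ℂ) * e) e s := by
      simpa using (Complex.ofRealCLM.hasDerivAt (x := s)).mul_const e
    exact (hf _ (hmem s hs)).hasFDerivAt.comp_hasDerivAt s hray
  refine norm_sub_le_integral_of_norm_deriv_le_of_le (f := fun x : ℝ => f (x * e)) hab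
    (fun s hs => (hderiv s hs).continuousAt.continuousWithinAt)
    (fun s hs => (hderiv s (Ioo_subset_Icc_self hs)).differentiableAt.differentiableWithinAt)
    (Eventually.of_forall fun s hs => ?_) hint
  have hs := Ioo_subset_Icc_self hs
  rw [(hderiv s hs).deriv]
  calc ‖fderiv ℝ f (s * e) e‖ ≤ ‖fderiv ℝ f (s * e)‖ * ‖e‖ := ContinuousLinearMap.le_opNorm _ _
    _ ≤ u s := by
      rw [he, mul_one]
      exact (hbound _ (hmem s hs)).trans_eq (by rw [hnorm s hs])

/-- Mean value inequality along a circle centred at the origin. -/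
lemma norm_sub_le_of_fderiv_le_circle {s C : ℝ} (hs : 0 ≤ s)
    (hf : ∀ t : ℂ, ‖t‖ = s → DifferentiableAt ℝ f t)
    (hbound : ∀ t : ℂ, ‖t‖ = s → ‖fderiv ℝ f t‖ ≤ C) (θ : ℝ) :
    ‖f (s * Complex.exp (θ * Complex.I)) - f s‖ ≤ s * C * |θ| := by
  have hnorm : ∀ x : ℝ, ‖(s : ℂ) * Complex.exp (x * Complex.I)‖ = s := fun x => by
    simp [Complex.norm_exp_ofReal_mul_I, abs_of_nonneg hs]
  have hderiv : ∀ x : ℝ, HasDerivAt (fun y : ℝ => f (s * Complex.exp (y * Complex.I)))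
      (fderiv ℝ f (s * Complex.exp (x * Complex.I))
        (s * (Complex.exp (x * Complex.I) * Complex.I))) x := fun x => by
    have harc : HasDerivAt (fun y : ℝ => (s : ℂ) * Complex.exp (y * Complex.I))
        (s * (Complex.exp (x * Complex.I) * Complex.I)) x := by
      have hlin : HasDerivAt (fun y : ℝ => (y : ℂ) * Complex.I) Complex.I x := by
        simpa using (Complex.ofRealCLM.hasDerivAt (x := x)).mul_const Complex.I
      exact hlin.cexp.const_mul _
    exact (hf _ (hnorm x)).hasFDerivAt.comp_hasDerivAt x harc
  have hmv := convex_univ.norm_image_sub_le_of_norm_hasDerivWithin_le (C := s * C)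
    (fun x _ => (hderiv x).hasDerivWithinAt) (fun x _ => ?_) (mem_univ 0) (mem_univ θ)
  · simpa using hmv
  · calc _ ≤ ‖fderiv ℝ f (s * Complex.exp (x * Complex.I))‖ *
          ‖(s : ℂ) * (Complex.exp (x * Complex.I) * Complex.I)‖ :=
        ContinuousLinearMap.le_opNorm _ _
      _ = ‖fderiv ℝ f (s * Complex.exp (x * Complex.I))‖ * s := by
        simp [Complex.norm_exp_ofReal_mul_I, abs_of_nonneg hs]
      _ ≤ s * C := by
        rw [mul_comm]
        exact mul_le_mul_of_nonneg_left (hbound _ (hnorm x)) hs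

end RadialBound

/-- Blel–Demailly–Mouzali Lemma 3.5: a `C¹` function on a punctured disc whose
real Fréchet derivative is bounded by an integrable radial function admits a
limit at the origin. -/
theorem punctured_disc_limit_of_deriv_bound
    (r₀ : ℝ) (hr₀ : 0 < r₀) (f : ℂ → ℂ) (u : ℝ → ℝ)
    (hf : ContDiffOn ℝ 1 f {t : ℂ | 0 < ‖t‖ ∧ ‖t‖ < r₀})
    (hu_meas : Measurable u)
    (hu_nonneg : ∀ s ∈ Ioo (0:ℝ) r₀, 0 ≤ u s)
    (hbound : ∀ t : ℂ, 0 < ‖t‖ → ‖t‖ < r₀ → ‖fderiv ℝ f t‖ ≤ u ‖t‖)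
    (hint : IntegrableOn u (Ioo (0:ℝ) r₀)) :
    ∃ L : ℂ, Tendsto f (nhdsWithin 0 {(0:ℂ)}ᶜ) (nhds L) := by
  have hdiff : ∀ t : ℂ, 0 < ‖t‖ → ‖t‖ < r₀ → DifferentiableAt ℝ f t := fun t h0 h1 =>
    (hf.differentiableOn one_ne_zero).differentiableAt <|
      ((isOpen_lt continuous_const continuous_norm).inter
        (isOpen_lt continuous_norm continuous_const)).mem_nhds ⟨h0, h1⟩
  have hii : IntervalIntegrable u volume 0 r₀ :=
    (intervalIntegrable_iff_integrableOn_Ioo_of_le hr₀.le).2 hint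
  have hsub : ∀ a b, 0 ≤ a → a ≤ b → b ≤ r₀ → IntervalIntegrable u volume a b :=
    fun a b h0 hab hb => hii.mono_set <| by
      rw [uIcc_of_le hab, uIcc_of_le hr₀.le]
      exact Icc_subset_Icc h0 hb
  have hradial : ∀ (e : ℂ) (a b : ℝ), ‖e‖ = 1 → 0 < a → a ≤ b → b < r₀ →
      ‖f (b * e) - f (a * e)‖ ≤ (∫ s in 0..b, u s) - ∫ s in 0..a, u s :=
    fun e a b he ha hab hb => by
      rw [intervalIntegral.integral_interval_sub_left (hsub 0 b le_rfl (ha.le.trans hab) hb.le)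
        (hsub 0 a le_rfl ha.le (hab.trans hb.le))]
      exact norm_sub_le_integral_of_fderiv_le_radial he ha hab
        (fun t ht => hdiff t (ha.trans_le ht.1) (ht.2.trans_lt hb))
        (fun t ht => hbound t (ha.trans_le ht.1) (ht.2.trans_lt hb)) (hsub a b ha.le hab hb.le)
  refine cauchy_map_iff_exists_tendsto.1 (Metric.cauchy_iff.2 ⟨inferInstance, fun ε hε => ?_⟩)
  have hη : 0 < ε / 12 := by positivity
  obtain ⟨δ, hδ, hprim⟩ := Metric.continuousWithinAt_iff.1
    (intervalIntegral.continuousOn_primitive_interval' hii left_mem_uIcc 0 left_mem_uIcc) _ hη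
  have hprim_lt : ∀ x, 0 < x → x < min δ r₀ → |∫ s in 0..x, u s| < ε / 12 := fun x h0 hx => by
    have hxmem : x ∈ uIcc 0 r₀ := by
      rw [uIcc_of_le hr₀.le]
      exact ⟨h0.le, (hx.trans_le (min_le_right _ _)).le⟩
    simpa using hprim hxmem (by simpa [abs_of_pos h0] using hx.trans_le (min_le_left _ _))
  have hρ : 0 < min δ r₀ := lt_min hδ hr₀
  obtain ⟨s, ⟨hs0, hsρ⟩, hsu⟩ := exists_mul_lt_of_integrableOn_Ioo hρ hη
    (hint.mono_set (Ioo_subset_Ioo_right (min_le_right _ _)))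
  have hsr : s < r₀ := hsρ.trans_le (min_le_right _ _)
  have hclose : ∀ t : ℂ, 0 < ‖t‖ → ‖t‖ < min δ r₀ → ‖f t - f s‖ < ε / 2 := fun t h0 ht => by
    set e := Complex.exp (t.arg * Complex.I) with he_def
    have he : ‖e‖ = 1 := Complex.norm_exp_ofReal_mul_I _
    have hte : f t = f (‖t‖ * e) := by rw [he_def, Complex.norm_mul_exp_arg_mul_I]
    have hcirc : ‖f (s * e) - f s‖ ≤ s * u s * |t.arg| :=
      norm_sub_le_of_fderiv_le_circle hs0.le
        (fun z hz => hdiff z (hz ▸ hs0) (hz ▸ hsr))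
        (fun z hz => (hbound z (hz ▸ hs0) (hz ▸ hsr)).trans_eq (by rw [hz])) _
    have harc : s * u s * |t.arg| ≤ ε / 12 * 4 :=
      mul_le_mul hsu.le ((Complex.abs_arg_le_pi t).trans Real.pi_le_four) (abs_nonneg _) hη.le
    have hray : ‖f (‖t‖ * e) - f (s * e)‖ < ε / 12 + ε / 12 := by
      have hT := abs_lt.1 (hprim_lt _ h0 ht)
      have hS := abs_lt.1 (hprim_lt _ hs0 hsρ)
      rcases le_total s ‖t‖ with h | h
      · linarith [hradial e s ‖t‖ he hs0 h (ht.trans_le (min_le_right _ _))]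
      · rw [norm_sub_rev]
        linarith [hradial e ‖t‖ s he h0 h hsr]
    rw [hte]
    linarith [norm_sub_le_norm_sub_add_norm_sub (f (‖t‖ * e)) (f (s * e)) (f s)]
  refine ⟨Metric.ball (f s) (ε / 2), ?_, fun x hx y hy => ?_⟩
  · rw [mem_map]
    filter_upwards [self_mem_nhdsWithin,
      mem_nhdsWithin_of_mem_nhds (Metric.ball_mem_nhds (0 : ℂ) hρ)] with t ht0 ht
    simpa [dist_eq_norm] using hclose t (norm_pos_iff.2 ht0) (mem_ball_zero_iff.1 ht)
  · linarith [dist_triangle_right x y (f s), Metric.mem_ball.1 hx, Metric.mem_ball.1 hy]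
end

section
/- Let r₀ > 0 and let f : ℂ → ℂ be a bounded function that is twice continuously differentiable (in the real sense, i.e. of class C² over ℝ) on the punctured disc D* = {t ∈ ℂ : 0 < |t| < r₀}. Suppose there is a measurable function u : (0, r₀) → [0, ∞) such that |Δf(t)| ≤ u(|t|) for every t ∈ D*, where Δf = ∂²f/∂x² + ∂²f/∂y² is the Laplacian of f regarded as a function of the two real coordinates of t = x + iy, and such that ∫₀^{r₀} s·|log s|·u(s) ds < ∞. Then f admits a finite limit at the origin: there exists L ∈ ℂ such that f(t) → L as t → 0 with t ≠ 0. -/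
open MeasureTheory Set Filter

/-- The restriction of `F` to the real line through `t` in the direction `v` is differentiable
near `t`, and its derivative has derivative `d` at `t`. -/
def HasSecondDerivAlong {E : Type*} [NormedAddCommGroup E] [NormedSpace ℝ E]
    (F : ℂ → E) (v t : ℂ) (d : E) : Prop :=
  ∃ F' : ℝ → E, (∀ᶠ x : ℝ in nhds 0, HasDerivAt (fun x : ℝ => F (t + x * v)) (F' x) x) ∧
    HasDerivAt F' d 0

namespace HasSecondDerivAlong

variable {E E' : Type*} [NormedAddCommGroup E] [NormedSpace ℝ E] [NormedAddCommGroup E']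
  [NormedSpace ℝ E'] {F G : ℂ → E} {v t : ℂ} {d e : E}

theorem add (hF : HasSecondDerivAlong F v t d) (hG : HasSecondDerivAlong G v t e) :
    HasSecondDerivAlong (fun z => F z + G z) v t (d + e) := by
  obtain ⟨F', hF1, hF2⟩ := hF
  obtain ⟨G', hG1, hG2⟩ := hG
  refine ⟨fun x => F' x + G' x, ?_, hF2.fun_add hG2⟩
  filter_upwards [hF1, hG1] with x hx hy using hx.fun_add hy

theorem clm_comp (L : E →L[ℝ] E') (hF : HasSecondDerivAlong F v t d) :
    HasSecondDerivAlong (fun z => L (F z)) v t (L d) := by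
  obtain ⟨F', hF1, hF2⟩ := hF
  refine ⟨fun x => L (F' x), ?_, L.hasFDerivAt.comp_hasDerivAt 0 hF2⟩
  filter_upwards [hF1] with x hx using L.hasFDerivAt.comp_hasDerivAt x hx

theorem sub (hF : HasSecondDerivAlong F v t d) (hG : HasSecondDerivAlong G v t e) :
    HasSecondDerivAlong (fun z => F z - G z) v t (d - e) := by
  simpa [sub_eq_add_neg] using hF.add (hG.clm_comp (-ContinuousLinearMap.id ℝ E))

/-- The second derivative test. -/
theorem nonpos_of_isLocalMax {F : ℂ → ℝ} {d : ℝ} (hF : HasSecondDerivAlong F v t d)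
    (hmax : IsLocalMax F t) : d ≤ 0 := by
  obtain ⟨F', hF1, hF2⟩ := hF
  by_contra! hd
  set y : ℝ → ℝ := fun x => F (t + x * v) with hy
  have hymax : IsLocalMax y 0 := by
    have hc : Tendsto (fun x : ℝ => t + x * v) (nhds 0) (nhds t) := by
      have : Continuous (fun x : ℝ => t + x * v) := by fun_prop
      simpa using this.tendsto 0
    have := hc.eventually hmax
    simpa [IsLocalMax, IsMaxFilter, hy] using this
  have hderiv : deriv y =ᶠ[nhds 0] F' := by
    filter_upwards [hF1] with x hx using hx.deriv
  have hymin : IsLocalMin y 0 := by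
    apply isLocalMin_of_deriv_deriv_pos
    · rw [hderiv.deriv_eq, hF2.deriv]; exact hd
    · exact hymax.deriv_eq_zero
    · exact hF1.self_of_nhds.continuousAt
  have hconst : y =ᶠ[nhds 0] fun _ => y 0 := by
    filter_upwards [hymax, hymin] with x h1 h2 using le_antisymm h1 h2
  have h0 : deriv (deriv y) 0 = 0 := by
    rw [hconst.deriv.deriv_eq]; simp
  rw [hderiv.deriv_eq, hF2.deriv] at h0
  exact hd.ne' h0

theorem of_contDiffOn {U : Set ℂ} (hU : IsOpen U) (hF : ContDiffOn ℝ 2 F U) (ht : t ∈ U) (v : ℂ) :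
    HasSecondDerivAlong F v t (fderiv ℝ (fun s => fderiv ℝ F s v) t v) := by
  have hline : ∀ x : ℝ, HasDerivAt (fun x : ℝ => t + x * v) v x := fun x => by
    simpa using ((hasDerivAt_id x).ofReal_comp.mul_const v).const_add t
  have hmem : ∀ᶠ x : ℝ in nhds 0, t + x * v ∈ U := by
    have hc : Tendsto (fun x : ℝ => t + x * v) (nhds 0) (nhds t) := by
      simpa using (hline 0).continuousAt.tendsto
    exact hc.eventually (hU.mem_nhds ht)
  refine ⟨fun x => fderiv ℝ F (t + x * v) v, ?_, ?_⟩
  · filter_upwards [hmem] with x hx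
    have : DifferentiableAt ℝ F (t + x * v) :=
      (hF.contDiffAt (hU.mem_nhds hx)).differentiableAt (by norm_num)
    exact this.hasFDerivAt.comp_hasDerivAt x (hline x)
  · have h1 : ContDiffAt ℝ 1 (fderiv ℝ F) t :=
      (hF.contDiffAt (hU.mem_nhds ht)).fderiv_right (by norm_num)
    have h2 : DifferentiableAt ℝ (fun s => fderiv ℝ F s v) t :=
      (h1.differentiableAt (by norm_num)).clm_apply (differentiableAt_const v)
    have h3 := h2.hasFDerivAt
    rw [show t = t + ((0 : ℝ) : ℂ) * v by simp] at h3
    have h4 := h3.comp_hasDerivAt 0 (hline 0)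
    simp only [Complex.ofReal_zero, zero_mul, add_zero] at h4
    exact h4

theorem polynomial_eval (P : Polynomial ℂ) (v t : ℂ) :
    HasSecondDerivAlong (fun z => P.eval z) v t
      (P.derivative.derivative.eval t * v ^ 2) := by
  have hline : ∀ x : ℝ, HasDerivAt (fun x : ℝ => t + x * v) v x := fun x => by
    simpa using ((hasDerivAt_id x).ofReal_comp.mul_const v).const_add t
  have hP : ∀ (Q : Polynomial ℂ) (x : ℝ), HasDerivAt (fun x : ℝ => Q.eval (t + x * v))
      (Q.derivative.eval (t + x * v) * v) x := fun Q x =>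
    HasDerivAt.comp (h₂ := fun z => Q.eval z) x (Q.hasDerivAt (t + x * v)) (hline x)
  refine ⟨fun x => P.derivative.eval (t + x * v) * v, .of_forall (hP P), ?_⟩
  simpa [pow_two, mul_assoc] using (hP P.derivative 0).mul_const v

end HasSecondDerivAlong

/-- Polar form of the Laplacian of a radial function: if `s φ' = A` and `A' = s k`, then
the Laplacian of `φ ‖·‖` is `k`. -/
theorem exists_hasSecondDerivAlong_radial {φ A : ℝ → ℝ} {t : ℂ} {k : ℝ} (ht : t ≠ 0)
    (hφ : ∀ᶠ s in nhds ‖t‖, HasDerivAt φ (A s / s) s) (hA : HasDerivAt A (‖t‖ * k) ‖t‖) :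
    ∃ d e : ℝ, HasSecondDerivAlong (fun z => φ ‖z‖) 1 t d ∧
      HasSecondDerivAlong (fun z => φ ‖z‖) Complex.I t e ∧ d + e = k := by
  have hn : 0 < ‖t‖ := norm_pos_iff.2 ht
  have key : ∀ v : ℂ, HasSecondDerivAlong (fun z => φ ‖z‖) v t
      (k * (t.re * v.re + t.im * v.im) ^ 2 / ‖t‖ ^ 2
        + A ‖t‖ * (v.re ^ 2 + v.im ^ 2) / ‖t‖ ^ 2
        - 2 * A ‖t‖ * (t.re * v.re + t.im * v.im) ^ 2 / ‖t‖ ^ 4) := by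
    intro v
    set p : ℝ → ℝ := fun x => (t.re + x * v.re) * v.re + (t.im + x * v.im) * v.im with hp
    set N : ℝ → ℝ := fun x => ‖t + x * v‖ with hN
    have hN0 : N 0 = ‖t‖ := by simp [hN]
    have hNsq : ∀ x, (t.re + x * v.re) ^ 2 + (t.im + x * v.im) ^ 2 = N x ^ 2 := by
      intro x
      rw [hN, Complex.sq_norm, Complex.normSq_apply]; simp; ring
    have hNc : Continuous N := by fun_prop
    have hNpos : ∀ᶠ x in nhds (0 : ℝ), 0 < N x :=
      (hNc.tendsto 0).eventually (lt_mem_nhds (by rw [hN0]; exact hn))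
    have hNd : ∀ x, 0 < N x → HasDerivAt N (p x / N x) x := by
      intro x hx
      have hlin : ∀ a b : ℝ, HasDerivAt (fun x : ℝ => a + x * b) b x := fun a b => by
        simpa using ((hasDerivAt_id x).mul_const b).const_add a
      have h1 := ((hlin t.re v.re).fun_pow 2).fun_add ((hlin t.im v.im).fun_pow 2)
      have h2 := h1.sqrt (by rw [hNsq]; positivity)
      simp only [hNsq, Real.sqrt_sq hx.le] at h2
      have h3 : (fun y => √(N y ^ 2)) = N := by
        ext y; exact Real.sqrt_sq (norm_nonneg _)
      rw [h3] at h2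
      refine h2.congr_deriv ?_
      simp only [hp]
      field_simp
      norm_num
    refine ⟨fun x => A (N x) * p x / N x ^ 2, ?_, ?_⟩
    · have hφ' := (hNc.tendsto 0).eventually (by rw [hN0]; exact hφ)
      filter_upwards [hNpos, hφ'] with x hx hφx
      refine (hφx.comp x (hNd x hx)).congr_deriv ?_
      field_simp
    · have hN1 := hNd 0 hNpos.self_of_nhds
      have hA1 : HasDerivAt (fun x => A (N x)) (‖t‖ * k * (p 0 / N 0)) 0 :=
        HasDerivAt.comp (h₂ := A) 0 (by rw [hN0]; exact hA) hN1
      have hp1 : HasDerivAt p (v.re ^ 2 + v.im ^ 2) 0 := by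
        have hlin : ∀ a b : ℝ, HasDerivAt (fun x : ℝ => (a + x * b) * b) (b ^ 2) 0 := fun a b => by
          simpa [pow_two] using (((hasDerivAt_id (0 : ℝ)).mul_const b).const_add a).mul_const b
        exact (hlin _ _).fun_add (hlin _ _)
      have hd := (hA1.fun_mul hp1).fun_div (hN1.fun_pow 2) (by rw [hN0]; positivity)
      refine hd.congr_deriv ?_
      have hp0 : p 0 = t.re * v.re + t.im * v.im := by simp [hp]
      rw [hN0, hp0]
      field_simp
      norm_num
      ring
  refine ⟨_, _, key 1, key Complex.I, ?_⟩
  have hsq : ‖t‖ ^ 2 = t.re ^ 2 + t.im ^ 2 := by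
    rw [Complex.sq_norm, Complex.normSq_apply]; ring
  have hsq4 : ‖t‖ ^ 4 = (t.re ^ 2 + t.im ^ 2) ^ 2 := by rw [← hsq]; ring
  have hpos : 0 < t.re ^ 2 + t.im ^ 2 := hsq ▸ pow_pos hn 2
  simp only [Complex.one_re, Complex.one_im, Complex.I_re, Complex.I_im, hsq, hsq4]
  field_simp
  ring

/-- Maximum principle with a removable puncture: a bounded above subharmonic function on a
punctured disc is bounded by its supremum on the outer circle. -/
theorem le_of_laplacian_nonneg_punctured_disc {G : ℂ → ℝ} {r C M : ℝ} (hr : 0 < r)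
    (hcont : ContinuousOn G {t : ℂ | 0 < ‖t‖ ∧ ‖t‖ ≤ r})
    (hM : ∀ t : ℂ, 0 < ‖t‖ → ‖t‖ ≤ r → G t ≤ M)
    (hC : ∀ t : ℂ, ‖t‖ = r → G t ≤ C)
    (hΔ : ∀ t : ℂ, 0 < ‖t‖ → ‖t‖ < r → ∃ d e : ℝ, HasSecondDerivAlong G 1 t d ∧
      HasSecondDerivAlong G Complex.I t e ∧ 0 ≤ d + e)
    {t : ℂ} (ht : 0 < ‖t‖) (htr : ‖t‖ ≤ r) : G t ≤ C := by
  let β : ℝ → ℝ := fun s => Real.log s + s ^ 2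
  have hβd : ∀ s : ℝ, 0 < s → HasDerivAt β ((1 + 2 * s ^ 2) / s) s := by
    intro s hs
    refine ((Real.hasDerivAt_log hs.ne').fun_add (hasDerivAt_pow 2 s)).congr_deriv ?_
    field_simp
    norm_num
    ring
  have hβbot : Tendsto β (nhdsWithin 0 (Ioi 0)) atBot := by
    refine Real.tendsto_log_nhdsGT_zero.atBot_add (C := 0) ?_
    have : Tendsto (fun s : ℝ => s ^ 2) (nhds 0) (nhds (0 ^ 2)) := (continuous_pow 2).tendsto 0
    simpa using this.mono_left nhdsWithin_le_nhds
  have key : ∀ ε : ℝ, 0 < ε → G t + ε * (β ‖t‖ - β r) ≤ C := by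
    intro ε hε
    set H : ℂ → ℝ := fun z => G z + ε * (β ‖z‖ - β r) with hH
    obtain ⟨ρ, hρ, hρt, hρr, hHρ⟩ : ∃ ρ, 0 < ρ ∧ ρ < ‖t‖ ∧ ρ < r ∧
        M + ε * (β ρ - β r) ≤ C := by
      have h1 : ∀ᶠ s in nhdsWithin (0 : ℝ) (Ioi 0), β s ≤ β r + (C - M) / ε :=
        hβbot.eventually (eventually_le_atBot _)
      have h2 : ∀ᶠ s in nhdsWithin (0 : ℝ) (Ioi 0), s ∈ Ioo 0 (min ‖t‖ r) :=
        Ioo_mem_nhdsGT (lt_min ht hr)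
      obtain ⟨ρ, hρ1, hρ2⟩ := (h1.and h2).exists
      refine ⟨ρ, hρ2.1, hρ2.2.trans_le (min_le_left _ _), hρ2.2.trans_le (min_le_right _ _), ?_⟩
      have : ε * (β ρ - β r) ≤ ε * ((C - M) / ε) := by gcongr; linarith
      rw [mul_div_cancel₀ _ hε.ne'] at this
      linarith
    set K : Set ℂ := {z | ρ ≤ ‖z‖ ∧ ‖z‖ ≤ r}
    have hKc : IsCompact K := by
      refine (isCompact_closedBall (0 : ℂ) r).of_isClosed_subset ?_ ?_
      · exact (isClosed_le continuous_const continuous_norm).inter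
          (isClosed_le continuous_norm continuous_const)
      · intro z hz; simpa using hz.2
    have hHc : ContinuousOn H K := by
      refine (hcont.mono fun z hz => ⟨hρ.trans_le hz.1, hz.2⟩).add ?_
      refine continuousOn_const.mul (ContinuousOn.sub ?_ continuousOn_const)
      refine ContinuousOn.add (ContinuousOn.log (by fun_prop) ?_) (by fun_prop)
      exact fun z hz => (hρ.trans_le hz.1).ne'
    obtain ⟨z, hzK, hzmax⟩ := hKc.exists_isMaxOn ⟨t, hρt.le, htr⟩ hHc
    refine le_trans (hzmax (show t ∈ K from ⟨hρt.le, htr⟩)) ?_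
    rcases hzK.1.eq_or_lt with hz1 | hz1
    · simp only [hH]
      rw [← hz1]
      linarith [hM z (hρ.trans_le hzK.1) hzK.2]
    rcases hzK.2.eq_or_lt with hz2 | hz2
    · simp only [hH]
      rw [hz2, sub_self, mul_zero, add_zero]
      exact hC z hz2
    exfalso
    have hz0 : 0 < ‖z‖ := hρ.trans hz1
    have hloc : IsLocalMax H z := by
      refine hzmax.isLocalMax ?_
      have : IsOpen {w : ℂ | ρ < ‖w‖ ∧ ‖w‖ < r} :=
        (isOpen_lt continuous_const continuous_norm).inter
          (isOpen_lt continuous_norm continuous_const)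
      exact mem_of_superset (this.mem_nhds ⟨hz1, hz2⟩) fun w hw => ⟨hw.1.le, hw.2.le⟩
    obtain ⟨d, e, hd, he, hde⟩ := hΔ z hz0 hz2
    obtain ⟨d', e', hd', he', hde'⟩ := exists_hasSecondDerivAlong_radial
      (φ := fun s => ε * (β s - β r)) (A := fun s => ε * (1 + 2 * s ^ 2)) (t := z) (k := 4 * ε)
      (norm_pos_iff.1 hz0)
      (by
        filter_upwards [lt_mem_nhds hz0] with s hs
        simpa [mul_div_assoc] using ((hβd s hs).sub_const (β r)).const_mul ε)
      (by
        refine ((((hasDerivAt_pow 2 ‖z‖).const_mul 2).const_add 1).const_mul ε).congr_deriv ?_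
        norm_num; ring)
    have h1 := (hd.add hd').nonpos_of_isLocalMax hloc
    have h2 := (he.add he').nonpos_of_isLocalMax hloc
    linarith
  have hlim : Tendsto (fun ε : ℝ => G t + ε * (β ‖t‖ - β r)) (nhdsWithin 0 (Ioi 0))
      (nhds (G t)) := by
    have : Continuous fun ε : ℝ => G t + ε * (β ‖t‖ - β r) := by fun_prop
    simpa using (this.tendsto 0).mono_left nhdsWithin_le_nhds
  exact le_of_tendsto hlim (eventually_mem_nhdsWithin.mono key)

/-- Continuous functions on a circle centred at the origin are uniform limits of harmonic
polynomials `P + conj Q`. -/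
theorem exists_harmonic_polynomial_near_circle {f : ℂ → ℂ} {r ε : ℝ} (hr : 0 < r) (hε : 0 < ε)
    (hf : ContinuousOn f {t : ℂ | ‖t‖ = r}) :
    ∃ P Q : Polynomial ℂ, ∀ t : ℂ, ‖t‖ = r →
      ‖f t - (P.eval t + (starRingEnd ℂ) (Q.eval t))‖ < ε := by
  have : Fact (0 < (1 : ℝ)) := ⟨one_pos⟩
  let γ : AddCircle (1 : ℝ) → ℂ := fun x => r * (AddCircle.toCircle x : ℂ)
  have hγc : Continuous γ :=
    continuous_const.mul (continuous_subtype_val.comp AddCircle.continuous_toCircle)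
  have hγn : ∀ x, ‖γ x‖ = r := fun x => by
    rw [norm_mul, Circle.norm_coe, Complex.norm_real, Real.norm_of_nonneg hr.le, mul_one]
  have hrC : (r : ℂ) ≠ 0 := by exact_mod_cast hr.ne'
  let F : C(AddCircle (1 : ℝ), ℂ) := ⟨fun x => f (γ x), hf.comp_continuous hγc hγn⟩
  have hspan : ∀ p ∈ Submodule.span ℂ (range (@fourier (1 : ℝ))), ∃ P Q : Polynomial ℂ,
      ∀ x, p x = P.eval (γ x) + (starRingEnd ℂ) (Q.eval (γ x)) := by
    have hpow : ∀ (n : ℕ) x, fourier (T := (1 : ℝ)) (n : ℤ) x =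
        (Polynomial.C ((r : ℂ)⁻¹ ^ n) * Polynomial.X ^ n).eval (γ x) := by
      intro n x
      simp only [fourier_apply, AddCircle.toCircle_zsmul, Polynomial.eval_mul, Polynomial.eval_C,
        Polynomial.eval_pow, Polynomial.eval_X, γ, ← mul_pow, inv_mul_cancel_left₀ hrC]
      simp
    intro p hp
    induction hp using Submodule.span_induction with
    | mem p hp =>
      obtain ⟨n, rfl⟩ := hp
      obtain ⟨m, rfl | rfl⟩ := n.eq_nat_or_neg
      · exact ⟨Polynomial.C ((r : ℂ)⁻¹ ^ m) * Polynomial.X ^ m, 0, fun x => by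
          rw [hpow m x, Polynomial.eval_zero, map_zero, add_zero]⟩
      · exact ⟨0, Polynomial.C ((r : ℂ)⁻¹ ^ m) * Polynomial.X ^ m, fun x => by
          rw [fourier_neg, hpow m x, Polynomial.eval_zero, zero_add]⟩
    | zero => exact ⟨0, 0, by simp⟩
    | add p q _ _ hp hq =>
      obtain ⟨P, Q, h⟩ := hp
      obtain ⟨P', Q', h'⟩ := hq
      refine ⟨P + P', Q + Q', fun x => ?_⟩
      simp only [ContinuousMap.add_apply, h, h', Polynomial.eval_add, map_add]
      ring
    | smul c p _ hp =>
      obtain ⟨P, Q, h⟩ := hp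
      refine ⟨Polynomial.C c * P, Polynomial.C ((starRingEnd ℂ) c) * Q, fun x => ?_⟩
      simp only [ContinuousMap.smul_apply, h, Polynomial.eval_mul, Polynomial.eval_C, map_mul,
        Complex.conj_conj, smul_eq_mul]
      ring
  have hF : F ∈ closure (Submodule.span ℂ (range (@fourier (1 : ℝ))) : Set _) := by
    rw [← Submodule.topologicalClosure_coe, span_fourier_closure_eq_top]
    trivial
  obtain ⟨p, hp, hdist⟩ := Metric.mem_closure_iff.1 hF ε hε
  obtain ⟨P, Q, hPQ⟩ := hspan p hp
  refine ⟨P, Q, fun t ht => ?_⟩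
  have ht' : ‖t / r‖ = 1 := by simp [ht, abs_of_pos hr, hr.ne']
  obtain ⟨x, hx⟩ := (AddCircle.homeomorphCircle (T := (1 : ℝ)) one_ne_zero).surjective
    ⟨t / r, mem_sphere_zero_iff_norm.2 ht'⟩
  have hγx : γ x = t := by
    rw [AddCircle.homeomorphCircle_apply] at hx
    simp only [γ, hx]
    field_simp
  have := (ContinuousMap.dist_apply_le_dist x).trans_lt hdist
  rwa [dist_eq_norm, hPQ, hγx, show F x = f t from congrArg f hγx] at this

/-- A continuous function on a punctured disc has a continuous optimal radial majorant. -/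
theorem exists_continuousOn_radial_majorant {Λ : ℂ → ℂ} {r₀ : ℝ} {u : ℝ → ℝ}
    (hΛ : ContinuousOn Λ {t : ℂ | 0 < ‖t‖ ∧ ‖t‖ < r₀})
    (hu : ∀ t : ℂ, 0 < ‖t‖ → ‖t‖ < r₀ → ‖Λ t‖ ≤ u ‖t‖) :
    ∃ g : ℝ → ℝ, ContinuousOn g (Ioo 0 r₀) ∧ (∀ t : ℂ, 0 < ‖t‖ → ‖t‖ < r₀ → ‖Λ t‖ ≤ g ‖t‖) ∧
      ∀ s ∈ Ioo 0 r₀, 0 ≤ g s ∧ g s ≤ u s := by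
  let K : Set ℂ := Metric.sphere 0 1
  have hK : IsCompact K := isCompact_sphere 0 1
  have hnorm : ∀ s ∈ Ioo 0 r₀, ∀ w : ℂ, ‖w‖ = 1 → ‖(s : ℂ) * w‖ = s := fun s hs w hw => by
    simp [hw, hs.1.le]
  let g : ℝ → ℝ := fun s => sSup ((fun w : ℂ => ‖Λ (s * w)‖) '' K)
  have hle : ∀ s ∈ Ioo 0 r₀, ∀ y ∈ (fun w : ℂ => ‖Λ (s * w)‖) '' K, y ≤ u s := by
    rintro s hs _ ⟨w, hw, rfl⟩
    have hn := hnorm s hs w (by simpa [K] using hw)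
    have := hu (s * w) (by rw [hn]; exact hs.1) (by rw [hn]; exact hs.2)
    rwa [hn] at this
  refine ⟨g, ?_, ?_, ?_⟩
  · rw [continuousOn_iff_continuous_domRestrict]
    have hc : Continuous fun x : Ioo 0 r₀ =>
        sSup ((fun w : K => ‖Λ ((x : ℝ) * (w : ℂ))‖) '' univ) := by
      have : CompactSpace K := isCompact_iff_compactSpace.1 hK
      refine isCompact_univ.continuous_sSup
        (f := fun (x : Ioo 0 r₀) (w : K) => ‖Λ ((x : ℝ) * (w : ℂ))‖) ?_
      refine (hΛ.comp_continuous (f := fun p : Ioo 0 r₀ × K => ((p.1 : ℝ) : ℂ) * (p.2 : ℂ))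
        (by fun_prop) fun p => ?_).norm
      have hn := hnorm p.1 p.1.2 p.2 (by simp)
      exact ⟨by rw [hn]; exact p.1.2.1, by rw [hn]; exact p.1.2.2⟩
    refine hc.congr fun x => ?_
    simp only [domRestrict_apply, g]
    congr 1
    ext y
    simp
  · intro t ht htr
    refine le_csSup ⟨u ‖t‖, hle ‖t‖ ⟨ht, htr⟩⟩ ⟨t / ‖t‖, ?_, ?_⟩
    · simp [K, ht.ne']
    · have : (‖t‖ : ℂ) ≠ 0 := by exact_mod_cast ht.ne'
      simp only [mul_div_cancel₀ t this]
  · intro s hs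
    refine ⟨Real.sSup_nonneg ?_, csSup_le ?_ (hle s hs)⟩
    · rintro _ ⟨w, _, rfl⟩; exact norm_nonneg _
    · exact ⟨_, 1, by simp [K], rfl⟩

/-- A radial potential `φ` of `g`, vanishing at the origin:
`φ s = ∫₀ˢ σ g(σ) log (s / σ) dσ`. -/
theorem exists_radial_potential {g : ℝ → ℝ} {R : ℝ} (hR : 0 < R) (hR1 : R < 1)
    (hg : ContinuousOn g (Ioo 0 R)) (hg0 : ∀ s ∈ Ioo 0 R, 0 ≤ g s)
    (hint : IntegrableOn (fun s => s * |Real.log s| * g s) (Ioo 0 R)) :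
    ∃ φ A : ℝ → ℝ, Tendsto φ (nhdsWithin 0 (Ioi 0)) (nhds 0) ∧
      (∀ s ∈ Ioo 0 R, HasDerivAt φ (A s / s) s) ∧
      ∀ s ∈ Ioo 0 R, HasDerivAt A (s * g s) s := by
  have hid : ContinuousOn (fun s : ℝ => s) (Ioo 0 R) := continuousOn_id
  have hlogc : ContinuousOn Real.log (Ioo 0 R) :=
    Real.continuousOn_log.mono fun s hs => hs.1.ne'
  have hac : ContinuousOn (fun s => s * g s) (Ioo 0 R) := hid.mul hg
  have hbc : ContinuousOn (fun s => s * g s * Real.log s) (Ioo 0 R) := hac.mul hlogc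
  have hlog : ∀ s ∈ Ioo 0 R, |Real.log R| ≤ |Real.log s| := by
    intro s hs
    rw [abs_of_neg (Real.log_neg hR hR1), abs_of_neg (Real.log_neg hs.1 (hs.2.trans hR1))]
    exact neg_le_neg (Real.log_le_log hs.1 hs.2.le)
  have hRlog : 0 < |Real.log R| := abs_pos.2 (Real.log_neg hR hR1).ne
  have ha : IntegrableOn (fun s => s * g s) (Ioo 0 R) := by
    refine (hint.const_mul |Real.log R|⁻¹).mono' (hac.aestronglyMeasurable measurableSet_Ioo) ?_
    filter_upwards [ae_restrict_mem measurableSet_Ioo] with s hs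
    have h0 : 0 ≤ s * g s := mul_nonneg hs.1.le (hg0 s hs)
    rw [Real.norm_of_nonneg h0, ← div_eq_inv_mul, le_div_iff₀ hRlog]
    calc s * g s * |Real.log R| ≤ s * g s * |Real.log s| := 
          mul_le_mul_of_nonneg_left (hlog s hs) h0
      _ = _ := by ring
  have hb : IntegrableOn (fun s => s * g s * Real.log s) (Ioo 0 R) := by
    refine hint.mono' (hbc.aestronglyMeasurable measurableSet_Ioo) ?_
    filter_upwards [ae_restrict_mem measurableSet_Ioo] with s hs
    have h0 : 0 ≤ s * g s := mul_nonneg hs.1.le (hg0 s hs)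
    rw [norm_mul, Real.norm_of_nonneg h0, Real.norm_eq_abs]
    exact le_of_eq (by ring)
  have hii : ∀ {h : ℝ → ℝ}, IntegrableOn h (Ioo 0 R) → ∀ s ∈ Ioo 0 R,
      IntervalIntegrable h volume 0 s := fun hh s hs =>
    (intervalIntegrable_iff_integrableOn_Ioc_of_le hs.1.le).2
      (hh.mono_set fun x hx => ⟨hx.1, hx.2.trans_lt hs.2⟩)
  have hderiv : ∀ {h : ℝ → ℝ}, IntegrableOn h (Ioo 0 R) → ContinuousOn h (Ioo 0 R) →
      ∀ s ∈ Ioo 0 R, HasDerivAt (fun x => ∫ y in (0 : ℝ)..x, h y) (h s) s := fun hh hc s hs =>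
    intervalIntegral.integral_hasDerivAt_right (hii hh s hs)
      (hc.stronglyMeasurableAtFilter isOpen_Ioo s hs) (hc.continuousAt (isOpen_Ioo.mem_nhds hs))
  have hzero : ∀ {h : ℝ → ℝ}, IntegrableOn h (Ioo 0 R) →
      Tendsto (fun x => ∫ y in (0 : ℝ)..x, h y) (nhdsWithin 0 (Ioi 0)) (nhds 0) := by
    intro h hh
    have hc := intervalIntegral.continuousOn_primitive_interval' (μ := volume)
      ((intervalIntegrable_iff_integrableOn_Ioo_of_le hR.le).2 hh) (left_mem_uIcc)
    have := hc 0 left_mem_uIcc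
    rw [uIcc_of_le hR.le] at this
    have h2 := this.tendsto.mono_left (nhdsWithin_le_of_mem (Icc_mem_nhdsGT hR))
    simpa using h2
  let A : ℝ → ℝ := fun x => ∫ y in (0 : ℝ)..x, y * g y
  let B : ℝ → ℝ := fun x => ∫ y in (0 : ℝ)..x, y * g y * Real.log y
  refine ⟨fun x => A x * Real.log x - B x, A, ?_, ?_, hderiv ha hac⟩
  · have hA : Tendsto (fun x => A x * Real.log x) (nhdsWithin 0 (Ioi 0)) (nhds 0) := by
      refine squeeze_zero_norm' ?_ (hzero hint)
      filter_upwards [Ioo_mem_nhdsGT hR] with s hs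
      have hA0 : 0 ≤ A s := intervalIntegral.integral_nonneg hs.1.le fun y hy => by
        rcases hy.1.eq_or_lt with h | h
        · simp [← h]
        · exact mul_nonneg hy.1 (hg0 y ⟨h, hy.2.trans_lt hs.2⟩)
      rw [norm_mul, Real.norm_of_nonneg hA0, Real.norm_eq_abs, ← intervalIntegral.integral_mul_const]
      refine intervalIntegral.integral_mono_on_of_le_Ioo hs.1.le ((hii ha s hs).mul_const _)
        (hii hint s hs) fun y hy => ?_
      have h0 : 0 ≤ y * g y := mul_nonneg hy.1.le (hg0 y ⟨hy.1, hy.2.trans hs.2⟩)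
      have hl : |Real.log s| ≤ |Real.log y| := by
        rw [abs_of_neg (Real.log_neg hs.1 (hs.2.trans hR1)),
          abs_of_neg (Real.log_neg hy.1 (hy.2.trans (hs.2.trans hR1)))]
        exact neg_le_neg (Real.log_le_log hy.1 hy.2.le)
      calc y * g y * |Real.log s| ≤ y * g y * |Real.log y| :=
          mul_le_mul_of_nonneg_left hl h0
        _ = _ := by ring
    simpa using hA.sub (hzero hb)
  · intro s hs
    refine (((hderiv ha hac s hs).fun_mul (Real.hasDerivAt_log hs.1.ne')).fun_sub
      (hderiv hb hbc s hs)).congr_deriv ?_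
    simp only [A]
    field_simp
    ring

/-- A harmonic polynomial `P + conj Q` that is close to `f` on a circle is close to `f` on the
punctured disc, up to the oscillation of a radial potential `φ` of the Laplacian of `f`. -/
theorem norm_sub_harmonic_polynomial_le {f : ℂ → ℂ} {r₀ r M η : ℝ} {φ A g : ℝ → ℝ}
    (hr : 0 < r) (hrr : r < r₀) (hM : ∀ t, ‖f t‖ ≤ M)
    (hf : ContDiffOn ℝ 2 f {t : ℂ | 0 < ‖t‖ ∧ ‖t‖ < r₀})
    (hΔ : ∀ t : ℂ, 0 < ‖t‖ → ‖t‖ ≤ r →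
      ‖fderiv ℝ (fun s => fderiv ℝ f s 1) t 1
        + fderiv ℝ (fun s => fderiv ℝ f s Complex.I) t Complex.I‖ ≤ g ‖t‖)
    (hφ : ∀ s ∈ Ioo 0 r₀, HasDerivAt φ (A s / s) s)
    (hA : ∀ s ∈ Ioo 0 r₀, HasDerivAt A (s * g s) s)
    (hφη : ∀ s ∈ Ioc 0 r, |φ s| ≤ η) {P Q : Polynomial ℂ}
    (hPQ : ∀ t : ℂ, ‖t‖ = r → ‖f t - (P.eval t + (starRingEnd ℂ) (Q.eval t))‖ < η)
    {t : ℂ} (ht : 0 < ‖t‖) (htr : ‖t‖ ≤ r) :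
    ‖f t - (P.eval t + (starRingEnd ℂ) (Q.eval t))‖ ≤ 3 * η := by
  have hopen : IsOpen {t : ℂ | 0 < ‖t‖ ∧ ‖t‖ < r₀} :=
    (isOpen_lt continuous_const continuous_norm).inter
      (isOpen_lt continuous_norm continuous_const)
  set h : ℂ → ℂ := fun z => P.eval z + (starRingEnd ℂ) (Q.eval z)
  have hhc : Continuous h :=
    P.continuous.add (Complex.continuous_conj.comp Q.continuous)
  obtain ⟨N, hN⟩ := (isCompact_closedBall (0 : ℂ) r).exists_bound_of_continuousOn hhc.continuousOn
  have key : ∀ c : ℂ, ‖c‖ ≤ 1 → (c * (f t - h t)).re ≤ 3 * η := by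
    intro c hc
    let L : ℂ →L[ℝ] ℝ := Complex.reCLM.comp (ContinuousLinearMap.mul ℝ ℂ c)
    have hLapply : ∀ z, L z = (c * z).re := fun z => rfl
    have hL : ∀ z, |L z| ≤ ‖z‖ := fun z => by
      rw [hLapply]
      refine (Complex.abs_re_le_norm _).trans ?_
      rw [norm_mul]
      exact mul_le_of_le_one_left (norm_nonneg z) hc
    have hmax : L (f t - h t) + φ ‖t‖ ≤ 2 * η := by
      refine le_of_laplacian_nonneg_punctured_disc (G := fun z => L (f z - h z) + φ ‖z‖)
        (M := M + N + η) hr ?_ ?_ ?_ ?_ ht htr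
      · refine (L.continuous.comp_continuousOn
          ((hf.continuousOn.mono fun z hz => ⟨hz.1, hz.2.trans_lt hrr⟩).sub
            hhc.continuousOn)).add ?_
        refine ContinuousOn.comp (t := Ioo 0 r₀)
          (fun s hs => (hφ s hs).continuousAt.continuousWithinAt) continuous_norm.continuousOn ?_
        exact fun z hz => ⟨hz.1, hz.2.trans_lt hrr⟩
      · intro z hz hzr
        have h1 := (le_abs_self _).trans (hL (f z - h z))
        have h2 := norm_sub_le (f z) (h z)
        have h3 := hN z (by simpa using hzr)
        have h4 := (le_abs_self _).trans (hφη ‖z‖ ⟨hz, hzr⟩)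
        linarith [hM z]
      · intro z hz
        have h1 := (le_abs_self _).trans (hL (f z - h z))
        have h4 := (le_abs_self _).trans (hφη ‖z‖ ⟨hz ▸ hr, hz.le⟩)
        linarith [hPQ z hz]
      · intro z hz hzr
        have hzmem : ‖z‖ ∈ Ioo 0 r₀ := ⟨hz, hzr.trans hrr⟩
        obtain ⟨d, e, hd, he, hde⟩ := exists_hasSecondDerivAlong_radial (φ := φ)
          (norm_pos_iff.1 hz) (mem_of_superset (isOpen_Ioo.mem_nhds hzmem) hφ) (hA _ hzmem)
        have hsecond : ∀ v : ℂ, HasSecondDerivAlong (fun z => L (f z - h z)) v z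
            (L (fderiv ℝ (fun s => fderiv ℝ f s v) z v
              - (P.derivative.derivative.eval z * v ^ 2
                + (starRingEnd ℂ) (Q.derivative.derivative.eval z * v ^ 2)))) := fun v =>
          ((HasSecondDerivAlong.of_contDiffOn hopen hf hzmem v).sub
            ((HasSecondDerivAlong.polynomial_eval P v z).add
              ((HasSecondDerivAlong.polynomial_eval Q v z).clm_comp
                Complex.conjCLE.toContinuousLinearMap))).clm_comp L
        refine ⟨_, _, (hsecond 1).add hd, (hsecond Complex.I).add he, ?_⟩
        rw [add_add_add_comm, hde, ← map_add]
        have hcancel : ∀ a b p q : ℂ, a - (p * 1 ^ 2 + (starRingEnd ℂ) (q * 1 ^ 2))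
            + (b - (p * Complex.I ^ 2 + (starRingEnd ℂ) (q * Complex.I ^ 2))) = a + b := by
          intro a b p q
          simp only [Complex.I_sq, map_mul, map_neg, map_one, one_pow]
          ring
        rw [hcancel]
        linarith [neg_le_of_abs_le ((hL _).trans (hΔ z hz hzr.le))]
    have := neg_le_of_abs_le (hφη ‖t‖ ⟨ht, htr⟩)
    rw [hLapply] at hmax
    linarith
  set w : ℂ := f t - h t
  rcases eq_or_ne w 0 with h0 | h0
  · simpa [h0] using key 0 (by simp)
  have hwn : (‖w‖ : ℂ) ≠ 0 := by exact_mod_cast (norm_pos_iff.2 h0).ne'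
  have h1 := key ((starRingEnd ℂ) w / ‖w‖) (by simp [norm_ne_zero_iff.2 h0])
  rwa [div_mul_eq_mul_div, ← Complex.normSq_eq_conj_mul_self, Complex.normSq_eq_norm_sq,
    ← Complex.ofReal_div, Complex.ofReal_re, pow_two,
    mul_div_cancel_right₀ _ (norm_ne_zero_iff.2 h0)] at h1

/-- Blel–Demailly–Mouzali Lemma 3.6: a bounded `C²` function on a punctured disc
whose Laplacian is bounded by a radial function `u` with
`∫₀^{r₀} s |log s| u(s) ds < ∞` admits a limit at the origin.  The Laplacian at
`t` is the sum of the second derivatives of `f` at `t` in the directions `1`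
and `i`. -/
theorem punctured_disc_limit_of_laplacian_bound
    (r₀ : ℝ) (hr₀ : 0 < r₀) (f : ℂ → ℂ) (u : ℝ → ℝ)
    (hbdd : ∃ M : ℝ, ∀ t : ℂ, ‖f t‖ ≤ M)
    (hf : ContDiffOn ℝ 2 f {t : ℂ | 0 < ‖t‖ ∧ ‖t‖ < r₀})
    (hu_meas : Measurable u)
    (hu_nonneg : ∀ s ∈ Ioo (0:ℝ) r₀, 0 ≤ u s)
    (hbound : ∀ t : ℂ, 0 < ‖t‖ → ‖t‖ < r₀ →
      ‖fderiv ℝ (fun s => fderiv ℝ f s 1) t 1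
        + fderiv ℝ (fun s => fderiv ℝ f s Complex.I) t Complex.I‖ ≤ u ‖t‖)
    (hint : IntegrableOn (fun s => s * |Real.log s| * u s) (Ioo (0:ℝ) r₀)) :
    ∃ L : ℂ, Tendsto f (nhdsWithin 0 {(0:ℂ)}ᶜ) (nhds L) := by
  obtain ⟨M, hM⟩ := hbdd
  have hopen : IsOpen {t : ℂ | 0 < ‖t‖ ∧ ‖t‖ < r₀} :=
    (isOpen_lt continuous_const continuous_norm).inter
      (isOpen_lt continuous_norm continuous_const)
  have hsecond : ∀ v : ℂ, ContinuousOn (fun t => fderiv ℝ (fun s => fderiv ℝ f s v) t v)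
      {t : ℂ | 0 < ‖t‖ ∧ ‖t‖ < r₀} := by
    intro v
    have h1 : ContDiffOn ℝ 1 (fderiv ℝ f) {t : ℂ | 0 < ‖t‖ ∧ ‖t‖ < r₀} :=
      hf.fderiv_of_isOpen hopen (by norm_num)
    have h2 : ContDiffOn ℝ 1 (fun s => fderiv ℝ f s v) {t : ℂ | 0 < ‖t‖ ∧ ‖t‖ < r₀} :=
      h1.clm_apply contDiffOn_const
    exact (h2.continuousOn_fderiv_of_isOpen hopen (by norm_num)).clm_apply continuousOn_const
  obtain ⟨g, hgc, hg, hgu⟩ := exists_continuousOn_radial_majorant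
    ((hsecond 1).add (hsecond Complex.I)) hbound
  set R : ℝ := min r₀ (1 / 2)
  have hR : 0 < R := lt_min hr₀ (by norm_num)
  have hRr : R ≤ r₀ := min_le_left _ _
  have hR1 : R < 1 := (min_le_right _ _).trans_lt (by norm_num)
  have hsub : Ioo 0 R ⊆ Ioo 0 r₀ := Ioo_subset_Ioo_right hRr
  have hgint : IntegrableOn (fun s => s * |Real.log s| * g s) (Ioo 0 R) := by
    refine (hint.mono_set hsub).mono' ?_ ?_
    · refine ContinuousOn.aestronglyMeasurable ?_ measurableSet_Ioo
      have hlog : ContinuousOn Real.log (Ioo 0 R) :=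
        Real.continuousOn_log.mono fun s hs => hs.1.ne'
      exact (continuousOn_id.mul hlog.abs).mul (hgc.mono hsub)
    · filter_upwards [ae_restrict_mem measurableSet_Ioo] with s hs
      have h0 : 0 ≤ s * |Real.log s| := mul_nonneg hs.1.le (abs_nonneg _)
      rw [Real.norm_of_nonneg (mul_nonneg h0 (hgu s (hsub hs)).1)]
      exact mul_le_mul_of_nonneg_left (hgu s (hsub hs)).2 h0
  obtain ⟨φ, A, hφ0, hφ, hA⟩ := exists_radial_potential hR hR1 (hgc.mono hsub)
    (fun s hs => (hgu s (hsub hs)).1) hgint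
  have hfR : ContDiffOn ℝ 2 f {t : ℂ | 0 < ‖t‖ ∧ ‖t‖ < R} :=
    hf.mono fun t ht => ⟨ht.1, ht.2.trans_le hRr⟩
  have happrox : ∀ η > 0, ∃ a : ℂ, ∀ᶠ t in nhdsWithin (0 : ℂ) {0}ᶜ, ‖f t - a‖ ≤ 4 * η := by
    intro η hη
    obtain ⟨r, hr, hrη⟩ : ∃ r ∈ Ioo 0 R, ∀ s ∈ Ioc 0 r, |φ s| ≤ η := by
      have h1 : ∀ᶠ s in nhdsWithin (0 : ℝ) (Ioi 0), |φ s| < η := by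
        simpa using hφ0.eventually (Metric.ball_mem_nhds 0 hη)
      obtain ⟨ρ, hρ, hρη⟩ := mem_nhdsGT_iff_exists_Ioo_subset.1 h1
      have hρ0 : (0 : ℝ) < ρ := hρ
      refine ⟨min ρ R / 2, ⟨by positivity, ?_⟩, fun s hs => (hρη ⟨hs.1, ?_⟩).le⟩
      · linarith [min_le_right ρ R]
      · have : 0 < min ρ R := lt_min hρ0 hR
        linarith [hs.2, min_le_left ρ R]
    obtain ⟨P, Q, hPQ⟩ := exists_harmonic_polynomial_near_circle hr.1 hη
      (hfR.continuousOn.mono fun t (ht : ‖t‖ = r) => ⟨ht ▸ hr.1, ht ▸ hr.2⟩)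
    set h : ℂ → ℂ := fun z => P.eval z + (starRingEnd ℂ) (Q.eval z)
    have hhc : Continuous h := P.continuous.add (Complex.continuous_conj.comp Q.continuous)
    refine ⟨h 0, ?_⟩
    have h1 : ∀ᶠ t in nhdsWithin (0 : ℂ) {0}ᶜ, dist (h t) (h 0) < η :=
      ((hhc.tendsto 0).eventually (Metric.ball_mem_nhds _ hη)).filter_mono nhdsWithin_le_nhds
    have h2 : ∀ᶠ t in nhdsWithin (0 : ℂ) {0}ᶜ, ‖t‖ < r := by
      have : ∀ᶠ t in nhds (0 : ℂ), t ∈ Metric.ball 0 r := Metric.ball_mem_nhds 0 hr.1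
      simpa using this.filter_mono nhdsWithin_le_nhds
    filter_upwards [h1, h2, self_mem_nhdsWithin] with t ht1 ht2 ht0
    have h3 := norm_sub_harmonic_polynomial_le hr.1 hr.2 hM hfR
      (fun t ht htr => hg t ht (htr.trans_lt (hr.2.trans_le hRr))) hφ hA hrη hPQ
      (norm_pos_iff.2 ht0) ht2.le
    rw [dist_eq_norm] at ht1
    have h4 := norm_add_le (f t - h t) (h t - h 0)
    rw [sub_add_sub_cancel] at h4
    linarith
  refine cauchy_map_iff_exists_tendsto.1 (Metric.cauchy_iff.2 ⟨inferInstance, fun ε hε => ?_⟩)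
  obtain ⟨a, ha⟩ := happrox (ε / 16) (by positivity)
  refine ⟨Metric.closedBall a (4 * (ε / 16)), ?_, fun x hx y hy => ?_⟩
  · refine mem_map.2 (mem_of_superset ha fun t ht => ?_)
    simpa [dist_eq_norm] using ht
  · have h1 := dist_triangle_right x y a
    rw [Metric.mem_closedBall] at hx hy
    linarith
end

section
/- Let r > 0 and let κ : (0, ∞) → [0, ∞] be a measurable function. Then, as an identity of Lebesgue integrals with values in [0, ∞], ∫₀^{r} ( Σ_{n=0}^{∞} κ(2^{-n} s) ) · (1/s) ds = ∫₀^{r} ⌊ log(2r/s) / log 2 ⌋ · κ(s) · (1/s) ds, where log is the natural logarithm and ⌊·⌋ denotes the integer part (floor). -/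
open MeasureTheory Set Filter
open scoped ENNReal

/-- Invariance of `ds/s` under dilations. -/
theorem setLIntegral_Ioc_comp_mul_left_div {a : ℝ} (ha : 0 < a) (r : ℝ) (κ : ℝ → ℝ≥0∞) :
    ∫⁻ s in Ioc (0:ℝ) r, κ (a * s) * ENNReal.ofReal (1 / s)
      = ∫⁻ s in Ioc (0:ℝ) (a * r), κ s * ENNReal.ofReal (1 / s) := by
  have himage : (fun s : ℝ => a * s) '' Ioc 0 r = Ioc 0 (a * r) := by
    simpa using image_mul_left_Ioc ha 0 r
  rw [← himage, lintegral_image_eq_lintegral_abs_deriv_mul measurableSet_Ioc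
    (fun s _ => by simpa using ((hasDerivAt_id s).const_mul a).hasDerivWithinAt)
    (mul_right_injective₀ ha.ne').injOn]
  refine setLIntegral_congr_fun measurableSet_Ioc fun s hs => ?_
  have hs0 : 0 < s := hs.1
  have hinv : ENNReal.ofReal (1 / s) = ENNReal.ofReal |a| * ENNReal.ofReal (1 / (a * s)) := by
    rw [← ENNReal.ofReal_mul (abs_nonneg a), abs_of_pos ha]
    congr 1
    field_simp
  simp only [hinv]
  ring

/-- The floor `⌊log (2r/s) / log 2⌋` counts the `n` with `s ≤ 2⁻ⁿ r`. -/
theorem le_inv_two_pow_mul_iff_lt_floor_log {r s : ℝ} (hr : 0 < r) (hs : 0 < s) (n : ℕ) :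
    s ≤ (2:ℝ)⁻¹ ^ n * r ↔ (n : ℤ) < ⌊Real.log (2 * r / s) / Real.log 2⌋ := by
  have hlog : 0 < Real.log 2 := Real.log_pos one_lt_two
  rw [← Int.add_one_le_iff, Int.le_floor, le_div_iff₀ hlog]
  push_cast
  have hpow : ((n : ℝ) + 1) * Real.log 2 = Real.log (2 ^ (n + 1)) := by
    rw [Real.log_pow]; push_cast; ring
  rw [hpow, Real.log_le_log_iff (by positivity) (by positivity), le_div_iff₀ hs, inv_pow,
    ← div_eq_inv_mul, le_div_iff₀ (by positivity), pow_succ]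
  constructor <;> intro h <;> linarith

theorem tsum_indicator_Ioc_inv_two_pow_mul {r s : ℝ} (hr : 0 < r) (hs : 0 < s) (g : ℝ → ℝ≥0∞) :
    ∑' n : ℕ, (Ioc (0:ℝ) ((2:ℝ)⁻¹ ^ n * r)).indicator g s
      = ENNReal.ofReal ((⌊Real.log (2 * r / s) / Real.log 2⌋ : ℤ) : ℝ) * g s := by
  have hmem (n : ℕ) : s ∈ Ioc (0:ℝ) ((2:ℝ)⁻¹ ^ n * r) ↔
      n ∈ Finset.range ⌊Real.log (2 * r / s) / Real.log 2⌋.toNat := by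
    rw [mem_Ioc, le_inv_two_pow_mul_iff_lt_floor_log hr hs, Finset.mem_range, Int.lt_toNat]
    exact and_iff_right hs
  rw [tsum_eq_sum fun n hn => indicator_of_notMem (mt (hmem n).1 hn) g,
    Finset.sum_congr rfl fun n hn => indicator_of_mem ((hmem n).2 hn) g]
  rw [Finset.sum_const, Finset.card_range, nsmul_eq_mul]
  congr 1
  generalize ⌊Real.log (2 * r / s) / Real.log 2⌋ = m
  obtain hm | hm := le_total 0 m
  · lift m to ℕ using hm
    simp
  · rw [Int.toNat_of_nonpos hm, ENNReal.ofReal_of_nonpos (by exact_mod_cast hm), Nat.cast_zero]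

/-- `∫₀^r (∑ₙ κ(2⁻ⁿ s)) ds/s = ∫₀^r ⌊log(2r/s)/log 2⌋ κ(s) ds/s`. -/
theorem lintegral_tsum_eq_lintegral_floor
    (r : ℝ) (hr : 0 < r) (κ : ℝ → ℝ≥0∞) (hκ : Measurable κ) :
    ∫⁻ s in Ioo (0:ℝ) r,
        (∑' n : ℕ, κ ((2:ℝ)⁻¹ ^ n * s)) * ENNReal.ofReal (1 / s)
      = ∫⁻ s in Ioo (0:ℝ) r,
          ENNReal.ofReal ((⌊Real.log (2 * r / s) / Real.log 2⌋ : ℤ) : ℝ)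
            * κ s * ENNReal.ofReal (1 / s) := by
  have hg : Measurable fun s : ℝ => κ s * ENNReal.ofReal (1 / s) := by fun_prop
  have hsub (n : ℕ) : Ioc (0:ℝ) ((2:ℝ)⁻¹ ^ n * r) ⊆ Ioc 0 r :=
    Ioc_subset_Ioc_right
      (mul_le_of_le_one_left hr.le (pow_le_one₀ (by norm_num) (by norm_num)))
  rw [restrict_Ioo_eq_restrict_Ioc]
  calc
    _ = ∑' n : ℕ, ∫⁻ s in Ioc (0:ℝ) r, κ ((2:ℝ)⁻¹ ^ n * s) * ENNReal.ofReal (1 / s) := by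
      simp_rw [← ENNReal.tsum_mul_right]
      exact lintegral_tsum fun n => by fun_prop
    _ = ∑' n : ℕ, ∫⁻ s in Ioc (0:ℝ) r, (Ioc (0:ℝ) ((2:ℝ)⁻¹ ^ n * r)).indicator
          (fun s => κ s * ENNReal.ofReal (1 / s)) s := by
      refine tsum_congr fun n => ?_
      rw [setLIntegral_Ioc_comp_mul_left_div (by positivity), setLIntegral_indicator
        measurableSet_Ioc, inter_eq_left.2 (hsub n)]
    _ = ∫⁻ s in Ioc (0:ℝ) r, ∑' n : ℕ, (Ioc (0:ℝ) ((2:ℝ)⁻¹ ^ n * r)).indicator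
          (fun s => κ s * ENNReal.ofReal (1 / s)) s :=
      (lintegral_tsum fun n => (hg.indicator measurableSet_Ioc).aemeasurable).symm
    _ = _ := by
      refine setLIntegral_congr_fun measurableSet_Ioc fun s hs => ?_
      simp only [tsum_indicator_Ioc_inv_two_pow_mul hr hs.1, mul_assoc]
end

section
/- Let r > 0 and let κ : (0, ∞) → [0, ∞) be a measurable function. If ∫₀^{r} ( Σ_{n=0}^{∞} κ(2^{-n} s) ) · (1/s) ds < ∞ (the sum and the Lebesgue integral being taken in [0, ∞]), then ∫₀^{r} |log s| · κ(s) · (1/s) ds < ∞, where log is the natural logarithm. -/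
open MeasureTheory Set Filter
open scoped ENNReal

/-- The measure `ds / s` is invariant under dilations. -/
lemma setLIntegral_Ioo_comp_mul_left_mul_one_div {c : ℝ} (hc : 0 < c) (r : ℝ)
    (f : ℝ → ℝ≥0∞) :
    ∫⁻ s in Ioo 0 r, f (c * s) * ENNReal.ofReal (1 / s)
      = ∫⁻ s in Ioo 0 (c * r), f s * ENNReal.ofReal (1 / s) := by
  have himage : (fun s => c * s) '' Ioo 0 r = Ioo 0 (c * r) := by
    rw [image_mul_left_Ioo hc, mul_zero]
  rw [← himage, lintegral_image_eq_lintegral_abs_deriv_mul measurableSet_Ioo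
    (f' := fun _ => c) (fun s _ => by simpa using ((hasDerivAt_id s).const_mul c).hasDerivWithinAt)
    (mul_right_injective₀ hc.ne').injOn]
  refine setLIntegral_congr_fun measurableSet_Ioo fun s hs => ?_
  have hscale : ENNReal.ofReal (1 / s) = ENNReal.ofReal c * ENNReal.ofReal (1 / (c * s)) := by
    rw [← ENNReal.ofReal_mul hc.le]
    congr 1
    field_simp
  simp only [abs_of_pos hc, hscale]
  ring

/-- On `(0, r)`, `|log s|` is dominated by the number of `n` with `s < 2⁻ⁿ r`. -/
lemma ofReal_abs_log_le_tsum_indicator {r s : ℝ} (hs : s ∈ Ioo 0 r) :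
    ENNReal.ofReal |Real.log s| ≤ ENNReal.ofReal (|Real.log r| + Real.log 2)
      * ∑' n : ℕ, (Ioo 0 ((2:ℝ)⁻¹ ^ n * r)).indicator 1 s := by
  obtain ⟨hs0, hsr⟩ := hs
  have hr : 0 < r := hs0.trans hsr
  have hlog2 : 0 < Real.log 2 := Real.log_pos one_lt_two
  have hlog : Real.log s < Real.log r := Real.log_lt_log hs0 hsr
  set m := ⌈(Real.log r - Real.log s) / Real.log 2⌉₊
  have hm_le : Real.log r - Real.log s ≤ m * Real.log 2 :=
    (div_le_iff₀ hlog2).1 (Nat.le_ceil _)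
  have hm_pos : (1 : ℝ) ≤ m := by
    exact_mod_cast Nat.ceil_pos.2 (div_pos (sub_pos.2 hlog) hlog2)
  have hbound : |Real.log s| ≤ (|Real.log r| + Real.log 2) * m := by
    have := le_mul_of_one_le_right (abs_nonneg (Real.log r)) hm_pos
    have := neg_abs_le (Real.log r)
    have := le_abs_self (Real.log r)
    rw [abs_le]
    constructor <;> nlinarith
  have hmem : ∀ n ∈ Finset.range m, s ∈ Ioo 0 ((2:ℝ)⁻¹ ^ n * r) := by
    intro n hn
    have hn' := (lt_div_iff₀ hlog2).1 (Nat.lt_ceil.1 (Finset.mem_range.1 hn))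
    refine ⟨hs0, (Real.log_lt_log_iff hs0 (by positivity)).1 ?_⟩
    rw [Real.log_mul (by positivity) hr.ne', Real.log_pow, Real.log_inv]
    linarith
  calc ENNReal.ofReal |Real.log s|
      ≤ ENNReal.ofReal ((|Real.log r| + Real.log 2) * m) := ENNReal.ofReal_le_ofReal hbound
    _ = ENNReal.ofReal (|Real.log r| + Real.log 2)
        * ∑ n ∈ Finset.range m, (Ioo 0 ((2:ℝ)⁻¹ ^ n * r)).indicator 1 s := by
      rw [Finset.sum_congr rfl fun n hn => indicator_of_mem (hmem n hn) _,
        ENNReal.ofReal_mul (by positivity)]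
      simp
    _ ≤ _ := by gcongr; exact ENNReal.sum_le_tsum _

/-- If `∫₀^r (∑ₙ κ(2⁻ⁿ s)) ds/s < ∞` then `∫₀^r |log s| κ(s) ds/s < ∞`. -/
theorem lintegral_abs_log_lt_top_of_lintegral_tsum_lt_top
    (r : ℝ) (hr : 0 < r) (κ : ℝ → ℝ)
    (hκ_meas : Measurable κ) (hκ_nonneg : ∀ s : ℝ, 0 < s → 0 ≤ κ s)
    (hfin : ∫⁻ s in Ioo (0:ℝ) r,
        (∑' n : ℕ, ENNReal.ofReal (κ ((2:ℝ)⁻¹ ^ n * s)))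
          * ENNReal.ofReal (1 / s) < ⊤) :
    ∫⁻ s in Ioo (0:ℝ) r,
        ENNReal.ofReal (|Real.log s| * κ s) * ENNReal.ofReal (1 / s) < ⊤ := by
  set f : ℝ → ℝ≥0∞ := fun s => ENNReal.ofReal (κ s) * ENNReal.ofReal (1 / s)
  have hf_meas : Measurable f := by fun_prop
  have hsum : ∫⁻ s in Ioo (0:ℝ) r,
      (∑' n : ℕ, ENNReal.ofReal (κ ((2:ℝ)⁻¹ ^ n * s))) * ENNReal.ofReal (1 / s)
      = ∑' n : ℕ, ∫⁻ s in Ioo 0 ((2:ℝ)⁻¹ ^ n * r), f s := by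
    simp_rw [← ENNReal.tsum_mul_right]
    rw [lintegral_tsum fun n => by fun_prop]
    exact tsum_congr fun n => setLIntegral_Ioo_comp_mul_left_mul_one_div (by positivity) r
      fun s => ENNReal.ofReal (κ s)
  rw [hsum] at hfin
  calc ∫⁻ s in Ioo (0:ℝ) r, ENNReal.ofReal (|Real.log s| * κ s) * ENNReal.ofReal (1 / s)
      ≤ ∫⁻ s in Ioo (0:ℝ) r, ENNReal.ofReal (|Real.log r| + Real.log 2)
          * ∑' n : ℕ, (Ioo 0 ((2:ℝ)⁻¹ ^ n * r)).indicator f s := by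
        refine setLIntegral_mono' measurableSet_Ioo fun s hs => ?_
        have hind : ∀ n : ℕ, (Ioo 0 ((2:ℝ)⁻¹ ^ n * r)).indicator f s
            = (Ioo 0 ((2:ℝ)⁻¹ ^ n * r)).indicator 1 s * f s := fun n => by
          by_cases h : s ∈ Ioo 0 ((2:ℝ)⁻¹ ^ n * r) <;> simp only [h, indicator_of_mem,
            indicator_of_notMem, not_false_eq_true, Pi.one_apply, one_mul, zero_mul]
        simp_rw [hind]
        rw [ENNReal.tsum_mul_right, ENNReal.ofReal_mul (abs_nonneg _), mul_assoc,
          ← mul_assoc (ENNReal.ofReal (|Real.log r| + Real.log 2))]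
        exact mul_le_mul_left (ofReal_abs_log_le_tsum_indicator hs) _
    _ ≤ ∫⁻ s, ENNReal.ofReal (|Real.log r| + Real.log 2)
          * ∑' n : ℕ, (Ioo 0 ((2:ℝ)⁻¹ ^ n * r)).indicator f s := setLIntegral_le_lintegral _ _
    _ = ENNReal.ofReal (|Real.log r| + Real.log 2)
          * ∑' n : ℕ, ∫⁻ s in Ioo 0 ((2:ℝ)⁻¹ ^ n * r), f s := by
        rw [lintegral_const_mul' _ _ ENNReal.ofReal_ne_top,
          lintegral_tsum fun n => (hf_meas.indicator measurableSet_Ioo).aemeasurable]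
        simp_rw [lintegral_indicator measurableSet_Ioo]
    _ < ⊤ := ENNReal.mul_lt_top ENNReal.ofReal_lt_top hfin
end

section
/- Let E be a metric space, let μ and μ₁, μ₂, … be finite Borel measures on E such that μₙ converges weakly to μ, i.e. ∫ g dμₙ → ∫ g dμ for every bounded continuous function g : E → ℝ. Let (Wᵢ)_{i ∈ ι} be a family of open subsets of E whose topological boundaries ∂Wᵢ are pairwise disjoint (∂Wᵢ ∩ ∂Wⱼ = ∅ for i ≠ j). Then there is a countable subset C ⊆ ι such that for every index i ∈ ι \ C one has μₙ(Wᵢ) → μ(Wᵢ) as n → ∞. -/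
open MeasureTheory Set Filter

/-- Weak convergence of finite measures implies that the liminf of the measures of any open set
is at least the measure of the open set under the limit measure. -/
theorem MeasureTheory.FiniteMeasure.le_liminf_measure_open_of_tendsto {Ω ι : Type*} {L : Filter ι}
    [MeasurableSpace Ω] [TopologicalSpace Ω] [OpensMeasurableSpace Ω] [HasOuterApproxClosed Ω]
    {μ : FiniteMeasure Ω} {μs : ι → FiniteMeasure Ω} (μs_lim : Tendsto μs L (nhds μ))
    {G : Set Ω} (G_open : IsOpen G) :
    (μ : Measure Ω) G ≤ L.liminf fun i ↦ (μs i : Measure Ω) G := by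
  rcases L.eq_or_neBot with rfl | hne
  · simp
  have hmass : Tendsto (fun i ↦ (μs i : Measure Ω) univ) L (nhds ((μ : Measure Ω) univ)) := by
    simpa only [FiniteMeasure.ennreal_mass] using ENNReal.tendsto_coe.mpr μs_lim.mass
  refine le_of_forall_lt_imp_le_of_dense fun c hc ↦ ?_
  obtain ⟨r, hr, hcr⟩ := ENNReal.lt_iff_exists_add_pos_lt.mp hc
  have hcompl : ∀ᶠ i in L, (μs i : Measure Ω) Gᶜ < (μ : Measure Ω) Gᶜ + r :=
    eventually_lt_of_limsup_lt <|
      (limsup_measure_closed_le_of_tendsto μs_lim G_open.isClosed_compl).trans_lt <|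
        ENNReal.lt_add_right (measure_ne_top _ _) (by simpa using hr.ne')
  have huniv : c + r + (μ : Measure Ω) Gᶜ < (μ : Measure Ω) univ := by
    rw [← measure_add_measure_compl G_open.measurableSet]
    exact ENNReal.add_lt_add_right (measure_ne_top _ _) hcr
  refine le_liminf_of_le (by isBoundedDefault) ?_
  filter_upwards [hcompl, hmass.eventually_const_lt huniv] with i hi hi'
  rw [← measure_add_measure_compl G_open.measurableSet] at hi'
  refine (ENNReal.add_le_add_iff_right
    (ENNReal.add_ne_top.mpr ⟨measure_ne_top (μ : Measure Ω) Gᶜ, ENNReal.coe_ne_top (r := r)⟩)).mp ?_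
  calc c + ((μ : Measure Ω) Gᶜ + r) = c + r + (μ : Measure Ω) Gᶜ := by ring
    _ ≤ (μs i : Measure Ω) G + (μs i : Measure Ω) Gᶜ := hi'.le
    _ ≤ (μs i : Measure Ω) G + ((μ : Measure Ω) Gᶜ + r) := by gcongr

/-- If finite Borel measures `μₙ` converge weakly to `μ` on a metric space and
`(Wᵢ)` is a family of open sets with pairwise disjoint boundaries, then
`μₙ(Wᵢ) → μ(Wᵢ)` for all `i` outside a countable set. -/
theorem weak_convergence_open_sets_off_countable
    {E : Type*} [MetricSpace E] [MeasurableSpace E] [BorelSpace E] {ι : Type*}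
    (μ : Measure E) (μs : ℕ → Measure E)
    [IsFiniteMeasure μ] [∀ n, IsFiniteMeasure (μs n)]
    (hweak : ∀ g : BoundedContinuousFunction E ℝ,
      Tendsto (fun n => ∫ x, g x ∂(μs n)) atTop (nhds (∫ x, g x ∂μ)))
    (W : ι → Set E) (hW : ∀ i, IsOpen (W i))
    (hdisj : ∀ i j, i ≠ j → frontier (W i) ∩ frontier (W j) = ∅) :
    ∃ C : Set ι, C.Countable ∧ ∀ i ∉ C,
      Tendsto (fun n => μs n (W i)) atTop (nhds (μ (W i))) := by
  refine ⟨{i | 0 < μ (frontier (W i))}, Measure.countable_meas_pos_of_disjoint_iUnion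
    (fun i ↦ isClosed_frontier.measurableSet)
    (fun i j hij ↦ disjoint_iff_inter_eq_empty.mpr (hdisj i j hij)), fun i hi ↦ ?_⟩
  let ν : FiniteMeasure E := ⟨μ, inferInstance⟩
  let νs : ℕ → FiniteMeasure E := fun n ↦ ⟨μs n, inferInstance⟩
  have hlim : Tendsto νs atTop (nhds ν) :=
    FiniteMeasure.tendsto_iff_forall_integral_tendsto.mpr hweak
  refine tendsto_measure_of_le_liminf_measure_of_limsup_measure_le Subset.rfl subset_closure ?_
    (FiniteMeasure.le_liminf_measure_open_of_tendsto hlim (hW i))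
    (FiniteMeasure.limsup_measure_closed_le_of_tendsto hlim isClosed_closure)
  rw [← (hW i).frontier_eq]
  simpa using hi
end

section
/- Let r₀ > 0 and let κ : (0, ∞) → [0, ∞) be a measurable function such that ∫₀^{r₀} ( Σ_{n=0}^{∞} κ(2^{-n} s) ) · (1/s) ds < ∞ (the sum and the Lebesgue integral taken in [0, ∞]). Let C > 0 and let f : ℂ → ℂ be a bounded function that is twice continuously differentiable (in the real sense) on the punctured disc D* = {t ∈ ℂ : 0 < |t| < r₀}, and suppose |Δf(t)| ≤ C · κ(|t|) / |t|² for every t ∈ D*, where Δf is the Laplacian of f regarded as a function of the two real coordinates of t. Then f admits a finite limit at the origin: there exists L ∈ ℂ such that f(t) → L as t → 0 with t ≠ 0. -/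
open MeasureTheory Set Filter
open scoped ENNReal
open scoped Topology
open InnerProductSpace Laplacian

/-- At a local maximum the second derivative is nonpositive. -/
theorem nonpos_of_isLocalMax_of_hasDerivAt_hasDerivAt {φ φ' : ℝ → ℝ} {m a : ℝ}
    (hmax : IsLocalMax φ a) (h₁ : ∀ᶠ s in 𝓝 a, HasDerivAt φ (φ' s) s)
    (h₂ : HasDerivAt φ' m a) : m ≤ 0 := by
  by_contra! hm
  have hd : deriv φ =ᶠ[𝓝 a] φ' := h₁.mono fun s hs => hs.deriv
  have hdd : deriv (deriv φ) a = m := by rw [hd.deriv_eq, h₂.deriv]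
  have hmin : IsLocalMin φ a :=
    isLocalMin_of_deriv_deriv_pos (by rw [hdd]; exact hm) hmax.deriv_eq_zero
      h₁.self_of_nhds.continuousAt
  have hconst : φ =ᶠ[𝓝 a] fun _ => φ a := by
    filter_upwards [hmax, hmin] with s h h' using le_antisymm h h'
  have : deriv φ =ᶠ[𝓝 a] fun _ => 0 := by
    simpa using hconst.deriv
  rw [this.deriv_eq] at hdd
  simp at hdd
  exact hm.ne hdd

/-- On the complex plane the Laplacian is the sum of the second derivatives in the directions
`1` and `I`. -/
theorem ContDiffAt.laplacian_eq_fderiv_fderiv {f : ℂ → ℂ} {t : ℂ} (hf : ContDiffAt ℝ 2 f t) :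
    Δ f t = fderiv ℝ (fun s => fderiv ℝ f s 1) t 1
      + fderiv ℝ (fun s => fderiv ℝ f s Complex.I) t Complex.I := by
  have h : DifferentiableAt ℝ (fderiv ℝ f) t :=
    (hf.fderiv_right (m := 1) (by norm_num)).differentiableAt (by norm_num)
  rw [laplacian_eq_iteratedFDeriv_complexPlane]
  simp only [iteratedFDeriv_two_apply]
  rw [fderiv_clm_apply h (by fun_prop), fderiv_clm_apply h (by fun_prop)]
  simp

theorem continuousOn_laplacian_of_contDiffOn {f : ℂ → ℂ} {U : Set ℂ} (hU : IsOpen U)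
    (hf : ContDiffOn ℝ 2 f U) : ContinuousOn (Δ f) U := by
  have h := hf.continuousOn_iteratedFDerivWithin (m := 2) le_rfl hU.uniqueDiffOn
  have h' : ContinuousOn (iteratedFDeriv ℝ 2 f) U :=
    h.congr fun t ht => (iteratedFDerivWithin_of_isOpen 2 hU ht).symm
  have happly (v : Fin 2 → ℂ) : ContinuousOn (fun t => iteratedFDeriv ℝ 2 f t v) U :=
    (continuous_eval_const v).comp_continuousOn h'
  rw [laplacian_eq_iteratedFDeriv_complexPlane]
  exact (happly _).add (happly _)

/-- A continuous function on a circle is uniformly approximated by (the boundary values of) entire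
harmonic functions. -/
theorem exists_harmonicOnNhd_norm_sub_le_on_sphere {g : ℂ → ℂ} {r δ : ℝ} (hr : 0 < r)
    (hδ : 0 < δ) (hg : ContinuousOn g (Metric.sphere 0 r)) :
    ∃ H : ℂ → ℂ, HarmonicOnNhd H univ ∧ ∀ t : ℂ, ‖t‖ = r → ‖g t - H t‖ ≤ δ := by
  have : Fact (0 < (1 : ℝ)) := ⟨one_pos⟩
  have hcirc (x : AddCircle (1 : ℝ)) : ‖(r * fourier 1 x : ℂ)‖ = r := by
    rw [fourier_one, norm_mul, Circle.norm_coe, Complex.norm_real, Real.norm_of_nonneg hr.le,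
      mul_one]
  let G : C(AddCircle (1 : ℝ), ℂ) :=
    ⟨fun x => g (r * fourier 1 x), hg.comp_continuous (by fun_prop) fun x => by
      simpa using hcirc x⟩
  have hG : G ∈ (Submodule.span ℂ (range (@fourier 1))).topologicalClosure := by
    rw [span_fourier_closure_eq_top]; trivial
  obtain ⟨P, hP, hdist⟩ := Metric.mem_closure_iff.1 hG δ hδ
  have key : ∃ H : ℂ → ℂ, HarmonicOnNhd H univ ∧
      ∀ x : AddCircle (1 : ℝ), H (r * fourier 1 x) = P x := by
    clear hdist
    induction hP using Submodule.span_induction with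
    | mem P hP =>
      obtain ⟨n, rfl⟩ := hP
      have hpow (k : ℕ) (x : AddCircle (1 : ℝ)) :
          (fun z : ℂ => (z / r) ^ k) (r * fourier 1 x) = fourier (k : ℤ) x := by
        have : (r : ℂ) ≠ 0 := by exact_mod_cast hr.ne'
        simp [this, fourier_apply, AddCircle.toCircle_nsmul]
      have han (k : ℕ) (z : ℂ) : AnalyticAt ℂ (fun z : ℂ => (z / r) ^ k) z := by fun_prop
      obtain ⟨k, rfl | rfl⟩ := n.eq_nat_or_neg
      · exact ⟨_, fun z _ => (han k z).harmonicAt, hpow k⟩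
      · refine ⟨_, fun z _ => (han k z).harmonicAt_conj, fun x => ?_⟩
        rw [fourier_neg, ← hpow]
        rfl
    | zero => exact ⟨fun _ => 0, by simp, by simp⟩
    | add P Q _ _ hP hQ =>
      obtain ⟨H, hH, hHP⟩ := hP
      obtain ⟨H', hH', hHQ⟩ := hQ
      exact ⟨H + H', hH.add hH', fun x => congrArg₂ (· + ·) (hHP x) (hHQ x)⟩
    | smul c P _ hP =>
      obtain ⟨H, hH, hHP⟩ := hP
      refine ⟨_, hH.comp_CLM ((ContinuousLinearMap.mul ℝ ℂ) c), fun x => congrArg (c * ·) (hHP x)⟩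
  obtain ⟨H, hH, hHP⟩ := key
  refine ⟨H, hH, fun t ht => ?_⟩
  obtain ⟨x, rfl⟩ : ∃ x : AddCircle (1 : ℝ), (r * fourier 1 x : ℂ) = t := by
    have hc : t / r ∈ Metric.sphere (0 : ℂ) 1 := by simp [ht, abs_of_pos hr, hr.ne']
    obtain ⟨x, hx⟩ := (AddCircle.homeomorphCircle (one_ne_zero (α := ℝ))).surjective
      ⟨t / r, by simpa [Submonoid.unitSphere] using hc⟩
    refine ⟨x, ?_⟩
    have hx' := congrArg (fun z : Circle => (z : ℂ)) hx
    simp only [AddCircle.homeomorphCircle_apply] at hx'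
    rw [fourier_one, hx']
    have : (r : ℂ) ≠ 0 := by exact_mod_cast hr.ne'
    field_simp
  rw [hHP x]
  have := (ContinuousMap.dist_apply_le_dist x).trans hdist.le
  rwa [dist_eq_norm] at this

theorem hasDerivAt_comp_line {f : ℂ → ℂ} {t v : ℂ} {s : ℝ}
    (hf : DifferentiableAt ℝ f (t + s * v)) :
    HasDerivAt (fun s : ℝ => f (t + s * v)) (fderiv ℝ f (t + s * v) v) s := by
  have hl : HasDerivAt (fun s : ℝ => t + (s : ℂ) * v) v s := by
    simpa using ((Complex.ofRealCLM.hasDerivAt (x := s)).mul_const v).const_add t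
  exact hf.hasFDerivAt.comp_hasDerivAt s hl

theorem hasDerivAt_norm_comp_line {t v : ℂ} {s : ℝ} (ht : t + s * v ≠ 0) :
    HasDerivAt (fun s : ℝ => ‖t + s * v‖)
      (((t + s * v).re * v.re + (t + s * v).im * v.im) / ‖t + s * v‖) s := by
  have hre : HasDerivAt (fun s : ℝ => t.re + s * v.re) v.re s := by
    simpa using ((hasDerivAt_id s).mul_const v.re).const_add t.re
  have him : HasDerivAt (fun s : ℝ => t.im + s * v.im) v.im s := by
    simpa using ((hasDerivAt_id s).mul_const v.im).const_add t.im
  have hnorm (s : ℝ) :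
      ‖t + s * v‖ = √((t.re + s * v.re) ^ 2 + (t.im + s * v.im) ^ 2) := by
    rw [Complex.norm_eq_sqrt_sq_add_sq]; simp
  have hne : (t.re + s * v.re) ^ 2 + (t.im + s * v.im) ^ 2 ≠ 0 := by
    intro h
    exact ht (norm_eq_zero.1 (by rw [hnorm, h, Real.sqrt_zero]))
  have h := ((hre.pow 2).add (him.pow 2)).sqrt hne
  simp_rw [hnorm]
  refine h.congr_deriv ?_
  simp
  field_simp

/-- First and second derivatives along a line of a radial function `z ↦ w ‖z‖` where
`w` has derivative `g s / s`. -/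
theorem exists_hasDerivAt_radial_comp_line {w g : ℝ → ℝ} {g' R : ℝ} {t v : ℂ}
    (ht : 0 < ‖t‖) (htR : ‖t‖ < R)
    (hw : ∀ s, 0 < s → s < R → HasDerivAt w (g s / s) s) (hg : HasDerivAt g g' ‖t‖) :
    ∃ φ' : ℝ → ℝ,
      (∀ᶠ s in 𝓝 (0 : ℝ), HasDerivAt (fun s : ℝ => w ‖t + s * v‖) (φ' s) s) ∧
      HasDerivAt φ' (g' * (t.re * v.re + t.im * v.im) ^ 2 / ‖t‖ ^ 3
        + g ‖t‖ * ((v.re ^ 2 + v.im ^ 2) / ‖t‖ ^ 2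
          - 2 * (t.re * v.re + t.im * v.im) ^ 2 / ‖t‖ ^ 4)) 0 := by
  refine ⟨fun s => g ‖t + s * v‖ *
    ((t + s * v).re * v.re + (t + s * v).im * v.im) / ‖t + s * v‖ ^ 2, ?_, ?_⟩
  · have hcont : ContinuousAt (fun s : ℝ => ‖t + s * v‖) 0 := by fun_prop
    have h₁ : ∀ᶠ s : ℝ in 𝓝 0, 0 < ‖t + s * v‖ :=
      hcont.eventually_const_lt (by simpa using ht)
    have h₂ : ∀ᶠ s : ℝ in 𝓝 0, ‖t + s * v‖ < R :=
      hcont.eventually_lt_const (by simpa using htR)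
    filter_upwards [h₁, h₂] with s hs₁ hs₂
    refine ((hw _ hs₁ hs₂).comp s (hasDerivAt_norm_comp_line (norm_pos_iff.1 hs₁))).congr_deriv ?_
    field_simp
  · have hN := hasDerivAt_norm_comp_line (t := t) (v := v) (s := 0) (by simpa using ht)
    have hN' : HasDerivAt (fun s : ℝ => ‖t + s * v‖) ((t.re * v.re + t.im * v.im) / ‖t‖) 0 := by
      simpa using hN
    have hG := HasDerivAt.comp (0 : ℝ) (h₂ := g) (h := fun s : ℝ => ‖t + s * v‖)
      (by simpa using hg) hN'
    have hip : HasDerivAt (fun s : ℝ => (t + s * v).re * v.re + (t + s * v).im * v.im)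
        (v.re ^ 2 + v.im ^ 2) 0 := by
      have hre : HasDerivAt (fun s : ℝ => t.re + s * v.re) v.re 0 := by
        simpa using ((hasDerivAt_id (0 : ℝ)).mul_const v.re).const_add t.re
      have him : HasDerivAt (fun s : ℝ => t.im + s * v.im) v.im 0 := by
        simpa using ((hasDerivAt_id (0 : ℝ)).mul_const v.im).const_add t.im
      simpa [sq] using (hre.mul_const v.re).fun_add (him.mul_const v.im)
    refine ((hG.mul hip).div (hN'.pow 2) (by simpa using ht)).congr_deriv ?_
    simp
    field_simp
    ring

/-- If `w` has derivative `g s / s` and `g` has derivative `k / s` at `s = ‖t‖`, then the Laplacian of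
`z ↦ w ‖z‖` at `t` is `k / ‖t‖²`, and `Re (c h) + w ‖·‖` has no local maximum at `t` if this
exceeds `‖Δ h t‖`. -/
theorem not_isLocalMax_re_add_radial {h : ℂ → ℂ} {w g : ℝ → ℝ} {R k : ℝ} {c t : ℂ}
    (ht : 0 < ‖t‖) (htR : ‖t‖ < R)
    (hw : ∀ s, 0 < s → s < R → HasDerivAt w (g s / s) s) (hg : HasDerivAt g (k / ‖t‖) ‖t‖)
    (hh : ContDiffAt ℝ 2 h t) (hc : ‖c‖ ≤ 1) (hlap : ‖Δ h t‖ < k / ‖t‖ ^ 2) :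
    ¬ IsLocalMax (fun z => (c * h z).re + w ‖z‖) t := by
  intro hmax
  have hline (v : ℂ) : (c * fderiv ℝ (fun s => fderiv ℝ h s v) t v).re
      + (k / ‖t‖ * (t.re * v.re + t.im * v.im) ^ 2 / ‖t‖ ^ 3
        + g ‖t‖ * ((v.re ^ 2 + v.im ^ 2) / ‖t‖ ^ 2
          - 2 * (t.re * v.re + t.im * v.im) ^ 2 / ‖t‖ ^ 4)) ≤ 0 := by
    obtain ⟨φ', h₁, h₂⟩ := exists_hasDerivAt_radial_comp_line (v := v) ht htR hw hg
    have hl : Tendsto (fun s : ℝ => t + s * v) (𝓝 0) (𝓝 t) := by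
      have : ContinuousAt (fun s : ℝ => t + s * v) 0 := by fun_prop
      simpa [ContinuousAt] using this
    have hmax' : IsLocalMax (fun s : ℝ => (c * h (t + s * v)).re + w ‖t + s * v‖) 0 := by
      have := hl.eventually hmax
      simpa [IsLocalMax, IsMaxFilter] using this
    have hmul {F : ℝ → ℂ} {F' : ℂ} {s : ℝ} (hF : HasDerivAt F F' s) :
        HasDerivAt (fun s => (c * F s).re) (c * F').re s :=
      Complex.reCLM.hasFDerivAt.comp_hasDerivAt s (hF.const_mul c)
    have hdiff : ∀ᶠ s : ℝ in 𝓝 0, DifferentiableAt ℝ h (t + s * v) :=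
      hl.eventually ((hh.eventually (by simp)).mono fun z hz => hz.differentiableAt (by norm_num))
    have hdiff2 : DifferentiableAt ℝ (fun s => fderiv ℝ h s v) t :=
      ((hh.fderiv_right (m := 1) (by norm_num)).differentiableAt (by norm_num)).clm_apply
        (by fun_prop)
    refine nonpos_of_isLocalMax_of_hasDerivAt_hasDerivAt hmax'
      (φ' := fun s => (c * fderiv ℝ h (t + s * v) v).re + φ' s) ?_ ?_
    · filter_upwards [h₁, hdiff] with s hs₁ hs₂
      exact (hmul (hasDerivAt_comp_line hs₂)).add hs₁
    · have := hasDerivAt_comp_line (f := fun s => fderiv ℝ h s v) (t := t) (v := v) (s := 0)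
        (by simpa using hdiff2)
      simp only [Complex.ofReal_zero, zero_mul, add_zero] at this
      exact (hmul this).add h₂
  have hsum := add_le_add (hline 1) (hline Complex.I)
  have hsq : ‖t‖ ^ 2 = t.re ^ 2 + t.im ^ 2 := by
    rw [Complex.sq_norm, Complex.normSq_apply]; ring
  have hrad : (k / ‖t‖ * (t.re) ^ 2 / ‖t‖ ^ 3 + g ‖t‖ * (1 / ‖t‖ ^ 2 - 2 * t.re ^ 2 / ‖t‖ ^ 4))
      + (k / ‖t‖ * (t.im) ^ 2 / ‖t‖ ^ 3 + g ‖t‖ * (1 / ‖t‖ ^ 2 - 2 * t.im ^ 2 / ‖t‖ ^ 4))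
      = k / ‖t‖ ^ 2 := by
    field_simp
    linear_combination (-k + 2 * g ‖t‖) * hsq
  have hre : -‖Δ h t‖ ≤ (c * Δ h t).re := by
    have h1 := Complex.abs_re_le_norm (c * Δ h t)
    rw [norm_mul] at h1
    have h2 := mul_le_of_le_one_left (norm_nonneg (Δ h t)) hc
    linarith [neg_abs_le (c * Δ h t).re]
  rw [hh.laplacian_eq_fderiv_fderiv, mul_add, Complex.add_re] at hre
  rw [hh.laplacian_eq_fderiv_fderiv] at hlap
  simp at hsum hre hlap hrad
  linarith

/-- Maximum principle on a punctured disc with a radial barrier `w` tending to `-∞` at the origin. -/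
theorem norm_le_sub_radial_of_laplacian_lt {h : ℂ → ℂ} {w g k : ℝ → ℝ} {R r δ M : ℝ}
    (hrR : r < R)
    (hw : ∀ s, 0 < s → s < R → HasDerivAt w (g s / s) s)
    (hg : ∀ s, 0 < s → s < R → HasDerivAt g (k s / s) s)
    (hh : ∀ t : ℂ, 0 < ‖t‖ → ‖t‖ < R → ContDiffAt ℝ 2 h t)
    (hlap : ∀ t : ℂ, 0 < ‖t‖ → ‖t‖ < R → ‖Δ h t‖ < k ‖t‖ / ‖t‖ ^ 2)
    (hbdd : ∀ t : ℂ, ‖t‖ ≤ r → ‖h t‖ ≤ M) (hsph : ∀ t : ℂ, ‖t‖ = r → ‖h t‖ ≤ δ)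
    (hwr : w r ≤ 0) (hw0 : Tendsto w (𝓝[>] 0) atBot) {t : ℂ} (ht : 0 < ‖t‖) (htr : ‖t‖ ≤ r) :
    ‖h t‖ ≤ δ - w ‖t‖ := by
  obtain ⟨c, hc, hct⟩ : ∃ c : ℂ, ‖c‖ ≤ 1 ∧ (c * h t).re = ‖h t‖ := by
    rcases eq_or_ne (h t) 0 with h0 | h0
    · exact ⟨0, by simp, by simp [h0]⟩
    · refine ⟨starRingEnd ℂ (h t) / ‖h t‖, by simp [h0], ?_⟩
      rw [div_mul_eq_mul_div, mul_comm, Complex.mul_conj, Complex.normSq_eq_norm_sq,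
        ← Complex.ofReal_div, Complex.ofReal_re, sq, mul_self_div_self]
  have hre (z : ℂ) : (c * h z).re ≤ ‖h z‖ :=
    (Complex.re_le_norm _).trans (by
      rw [norm_mul]; exact mul_le_of_le_one_left (norm_nonneg _) hc)
  by_contra! hlt
  obtain ⟨ρ, hρt, hρ0, hρ⟩ : ∃ ρ < ‖t‖, 0 < ρ ∧ w ρ < δ - M := by
    have h1 := hw0.eventually (eventually_lt_atBot (δ - M))
    have h2 : ∀ᶠ ρ in 𝓝[>] (0 : ℝ), ρ < ‖t‖ := nhdsWithin_le_nhds (eventually_lt_nhds ht)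
    obtain ⟨ρ, h1, h2, h3⟩ := (h1.and (h2.and self_mem_nhdsWithin)).exists
    exact ⟨ρ, h2, h3, h1⟩
  set u : ℂ → ℝ := fun z => (c * h z).re + w ‖z‖ with hu
  set A : Set ℂ := {z | ρ ≤ ‖z‖ ∧ ‖z‖ ≤ r}
  have hA : IsCompact A := by
    refine (isCompact_closedBall (0 : ℂ) r).of_isClosed_subset ?_ fun z hz => by simpa using hz.2
    exact (isClosed_le continuous_const continuous_norm).inter
      (isClosed_le continuous_norm continuous_const)
  have hucont : ContinuousOn u A := fun z hz => by
    have hz0 : 0 < ‖z‖ := hρ0.trans_le hz.1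
    have hzR := hz.2.trans_lt hrR
    have h1 := (hh z hz0 hzR).continuousAt
    have h2 : ContinuousAt (fun z : ℂ => w ‖z‖) z :=
      ContinuousAt.comp (g := w) (hw _ hz0 hzR).continuousAt continuous_norm.continuousAt
    exact ((Complex.continuous_re.continuousAt.comp (continuousAt_const.mul h1)).add
      h2).continuousWithinAt
  have htA : t ∈ A := ⟨hρt.le, htr⟩
  obtain ⟨z, hzA, hzmax⟩ := hA.exists_isMaxOn ⟨t, htA⟩ hucont
  have hz0 : 0 < ‖z‖ := hρ0.trans_le hzA.1
  have huz : δ < u z := lt_of_lt_of_le (by rw [hu]; dsimp only; linarith) (hzmax htA)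
  have hzρ : ρ < ‖z‖ := lt_of_le_of_ne hzA.1 fun heq => by
    rw [hu] at huz; dsimp only at huz
    rw [← heq] at huz
    linarith [hre z, hbdd z hzA.2]
  have hzr : ‖z‖ < r := lt_of_le_of_ne hzA.2 fun heq => by
    rw [hu] at huz; dsimp only at huz
    rw [heq] at huz
    linarith [hre z, hsph z heq]
  have hnhds : A ∈ 𝓝 z := by
    filter_upwards [continuous_norm.continuousAt.eventually_const_lt hzρ,
      continuous_norm.continuousAt.eventually_lt_const hzr] with y h1 h2 using ⟨h1.le, h2.le⟩
  exact not_isLocalMax_re_add_radial hz0 (hzr.trans hrR) hw (hg _ hz0 (hzr.trans hrR))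
    (hh z hz0 (hzr.trans hrR)) hc (hlap z hz0 (hzr.trans hrR)) (hzmax.isLocalMax hnhds)

/-- The maximum over circles of the norm of a continuous function is continuous in the radius. -/
theorem exists_continuousOn_radial_majorant_s7 {G : ℂ → ℂ} {R : ℝ}
    (hG : ContinuousOn G {t : ℂ | 0 < ‖t‖ ∧ ‖t‖ < R}) :
    ∃ K : ℝ → ℝ, ContinuousOn K (Ioo 0 R) ∧
      (∀ t : ℂ, 0 < ‖t‖ → ‖t‖ < R → ‖G t‖ ≤ K ‖t‖) ∧
      ∀ s ∈ Ioo 0 R, ∃ t : ℂ, ‖t‖ = s ∧ K s = ‖G t‖ := by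
  set F : ℝ → ℂ → ℝ := fun s z => ‖G (s * z)‖ with hF
  have hcomp := isCompact_sphere (0 : ℂ) 1
  have hmem (s : Ioo 0 R) (z : Metric.sphere (0 : ℂ) 1) :
      (s * z : ℂ) ∈ {t : ℂ | 0 < ‖t‖ ∧ ‖t‖ < R} := by
    have hz : ‖(z : ℂ)‖ = 1 := by simp
    have hsz : ‖(s * z : ℂ)‖ = s := by
      rw [norm_mul, hz, Complex.norm_real, Real.norm_of_nonneg s.2.1.le, mul_one]
    rw [mem_ofPred_eq, hsz]
    exact s.2
  have hFcont : Continuous fun p : Ioo 0 R × Metric.sphere (0 : ℂ) 1 => F p.1 p.2 := by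
    refine (hG.comp_continuous (f := fun p : Ioo 0 R × Metric.sphere (0 : ℂ) 1 =>
      ((p.1 : ℝ) : ℂ) * (p.2 : ℂ)) (by fun_prop) fun p => hmem p.1 p.2).norm
  have hFs (s : ℝ) (hs : s ∈ Ioo 0 R) : ContinuousOn (F s) (Metric.sphere 0 1) := by
    rw [continuousOn_iff_continuous_domRestrict]
    exact hFcont.comp (by fun_prop : Continuous fun z : Metric.sphere (0 : ℂ) 1 =>
      ((⟨s, hs⟩ : Ioo 0 R), z))
  refine ⟨fun s => sSup (F s '' Metric.sphere 0 1), ?_, fun t ht htR => ?_, fun s hs => ?_⟩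
  · rw [continuousOn_iff_continuous_domRestrict]
    have := IsCompact.continuous_sSup
      (f := fun (s : Ioo 0 R) (z : Metric.sphere (0 : ℂ) 1) => F s z)
      (isCompact_iff_isCompact_univ.1 hcomp) hFcont
    refine this.congr fun s => ?_
    simp only [domRestrict_apply]
    congr 1
    ext y
    simp
  · refine le_csSup (hcomp.bddAbove_image (hFs _ ⟨ht, htR⟩)) ⟨t / ‖t‖, ?_, ?_⟩
    · simp [norm_pos_iff.1 ht]
    · have : (‖t‖ : ℂ) ≠ 0 := by exact_mod_cast ht.ne'
      simp only [hF]
      rw [mul_div_cancel₀ _ this]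
  · obtain ⟨z, hz, h, -⟩ := hcomp.exists_sSup_image_eq_and_ge ⟨1, by simp⟩ (hFs s hs)
    refine ⟨s * z, ?_, h⟩
    have : ‖z‖ = 1 := by simpa using hz
    simp [this, abs_of_pos hs.1]

theorem summable_integral_dyadic {κ : ℝ → ℝ} {R : ℝ} (hR : 0 < R) (hκ_meas : Measurable κ)
    (hκ_nonneg : ∀ s : ℝ, 0 < s → 0 ≤ κ s)
    (hκ_int : ∫⁻ s in Ioo (0:ℝ) R,
        (∑' n : ℕ, ENNReal.ofReal (κ ((2:ℝ)⁻¹ ^ n * s))) * ENNReal.ofReal (1 / s) < ⊤) :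
    IntegrableOn (fun s => κ s / s) (Ioo 0 R) ∧
      Summable fun n : ℕ => ∫ s in 0..(2:ℝ)⁻¹ ^ n * R, κ s / s := by
  set a : ℕ → ℝ → ℝ := fun n s => κ ((2:ℝ)⁻¹ ^ n * s) / s with ha
  have hmeas (n : ℕ) : Measurable (a n) :=
    (hκ_meas.comp (measurable_const_mul _)).div measurable_id
  have hnonneg (n : ℕ) : 0 ≤ᵐ[volume.restrict (Ioo 0 R)] a n := by
    filter_upwards [ae_restrict_mem measurableSet_Ioo] with s hs
    exact div_nonneg (hκ_nonneg _ (mul_pos (by positivity) hs.1)) hs.1.le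
  have hsum : ∑' n, ∫⁻ s in Ioo 0 R, ENNReal.ofReal (a n s) < ⊤ := by
    rw [← lintegral_tsum fun n => (hmeas n).ennreal_ofReal.aemeasurable]
    refine lt_of_eq_of_lt (setLIntegral_congr_fun measurableSet_Ioo fun s hs => ?_) hκ_int
    rw [← ENNReal.tsum_mul_right]
    refine tsum_congr fun n => ?_
    rw [← ENNReal.ofReal_mul (hκ_nonneg _ (mul_pos (by positivity) hs.1)), mul_one_div]
  have hint : IntegrableOn (a 0) (Ioo 0 R) :=
    ⟨(hmeas 0).aestronglyMeasurable,
      (hasFiniteIntegral_iff_ofReal (hnonneg 0)).2 ((ENNReal.le_tsum 0).trans_lt hsum)⟩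
  refine ⟨by simpa [ha] using hint, (ENNReal.summable_toReal hsum.ne).congr fun n => ?_⟩
  rw [← integral_eq_lintegral_of_nonneg_ae (hnonneg n) (hmeas n).aestronglyMeasurable,
    ← integral_Ioc_eq_integral_Ioo, ← intervalIntegral.integral_of_le hR.le]
  have := intervalIntegral.mul_integral_comp_mul_left (a := 0) (b := R)
    (f := fun s => κ s / s) (c := (2:ℝ)⁻¹ ^ n)
  rw [mul_zero] at this
  rw [← this, ← intervalIntegral.integral_const_mul]
  congr 1
  ext s
  simp only [ha]
  field_simp

theorem intervalIntegral_div_le_tsum_of_dyadic {J : ℝ → ℝ} {a : ℕ → ℝ} {R : ℝ} (hR : 0 < R)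
    (hJcont : ContinuousOn J (Ioo 0 R)) (hJ0 : ∀ s ∈ Ioo 0 R, 0 ≤ J s)
    (hJa : ∀ n, ∀ s ∈ Ioo 0 R, s ≤ (2:ℝ)⁻¹ ^ n * R → J s ≤ a n) (ha : Summable a)
    (ha0 : ∀ n, 0 ≤ a n) {N : ℕ} (hN : 0 < N) {ρ : ℝ} (hρ : 0 < ρ) (hρN : ρ ≤ (2:ℝ)⁻¹ ^ N * R) :
    ∫ s in ρ..(2:ℝ)⁻¹ ^ N * R, J s / s ≤ ∑' n, a (n + N) := by
  set x : ℕ → ℝ := fun n => (2:ℝ)⁻¹ ^ n * R with hx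
  have hxpos (n : ℕ) : 0 < x n := by positivity
  have hxanti : Antitone x := fun m n h => by
    simp only [hx]
    gcongr ?_ * R
    exact pow_le_pow_of_le_one (by norm_num) (by norm_num) h
  have hxR (n : ℕ) (hn : 0 < n) : x n < R := by
    simp only [hx]
    exact mul_lt_of_lt_one_left hR (pow_lt_one₀ (by norm_num) (by norm_num) hn.ne')
  have hcont : ContinuousOn (fun s => J s / s) (Ioo 0 R) :=
    hJcont.div continuousOn_id fun s hs => hs.1.ne'
  have hii {p q : ℝ} (hp : p ∈ Ioo 0 R) (hq : q ∈ Ioo 0 R) :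
      IntervalIntegrable (fun s => J s / s) volume p q :=
    (hcont.mono (OrdConnected.uIcc_subset inferInstance hp hq)).intervalIntegrable
  have hmem (n : ℕ) : x (n + N) ∈ Ioo 0 R := ⟨hxpos _, hxR _ (by omega)⟩
  have hpiece (n : ℕ) : ∫ s in x (n + 1 + N)..x (n + N), J s / s ≤ a (n + N) := by
    have hle : x (n + 1 + N) ≤ x (n + N) := hxanti (by omega)
    have hhalf : x (n + N) = 2 * x (n + 1 + N) := by
      simp only [hx, show n + 1 + N = n + N + 1 by ring, pow_succ]; ring
    calc ∫ s in x (n + 1 + N)..x (n + N), J s / s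
        ≤ ∫ _ in x (n + 1 + N)..x (n + N), a (n + N) / x (n + 1 + N) := by
          refine intervalIntegral.integral_mono_on hle (hii (hmem _) (hmem _)) (by simp)
            fun s hs => ?_
          have hs' : s ∈ Ioo 0 R := ⟨(hxpos _).trans_le hs.1, hs.2.trans_lt (hmem n).2⟩
          exact div_le_div₀ (ha0 _) (hJa _ s hs' hs.2) (hxpos _) hs.1
      _ = a (n + N) := by
          have := (hxpos (n + 1 + N)).ne'
          rw [intervalIntegral.integral_const, hhalf, smul_eq_mul]
          field_simp
          ring
  have hpartial (m : ℕ) :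
      ∫ s in x (m + N)..x N, J s / s ≤ ∑ n ∈ Finset.range m, a (n + N) := by
    induction m with
    | zero => simp
    | succ m ih =>
      rw [Finset.sum_range_succ, ← intervalIntegral.integral_add_adjacent_intervals
        (hii (hmem (m + 1)) (hmem m)) (hii (hmem m) (by simpa using hmem 0))]
      linarith [hpiece m]
  obtain ⟨m, hm⟩ : ∃ m : ℕ, x (m + N) ≤ ρ := by
    obtain ⟨m, hm⟩ := exists_pow_lt_of_lt_one (div_pos hρ hR) (by norm_num : (2:ℝ)⁻¹ < 1)
    refine ⟨m, (hxanti (Nat.le_add_right m N)).trans ?_⟩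
    exact ((lt_div_iff₀ hR).1 hm).le
  have hρmem : ρ ∈ Ioo 0 R := ⟨hρ, hρN.trans_lt (hxR N hN)⟩
  have hfirst : 0 ≤ ∫ s in x (m + N)..ρ, J s / s :=
    intervalIntegral.integral_nonneg hm fun s hs =>
      div_nonneg (hJ0 s ⟨(hxpos _).trans_le hs.1, hs.2.trans_lt hρmem.2⟩)
        ((hxpos _).trans_le hs.1).le
  have hsplit := intervalIntegral.integral_add_adjacent_intervals
    (hii (hmem m) hρmem) (hii hρmem (by simpa using hmem 0 : x N ∈ Ioo 0 R))
  have htail : ∑ n ∈ Finset.range m, a (n + N) ≤ ∑' n, a (n + N) :=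
    ((summable_nat_add_iff N).2 ha).sum_le_tsum _ fun n _ => ha0 _
  change ∫ s in ρ..x N, J s / s ≤ _
  linarith [hpartial m]

/-- A bounded function on a punctured disc with `‖Δ h t‖ ≤ K ‖t‖` is controlled by its values on a
circle and the solution of the radial equation with right-hand side `K`. -/
theorem norm_le_add_integral_of_norm_laplacian_le {h : ℂ → ℂ} {J K : ℝ → ℝ} {R r δ M : ℝ}
    (hr : r ∈ Ioo 0 R) (hJ : ∀ s ∈ Ioo 0 R, HasDerivAt J (s * K s) s)
    (hJ0 : ∀ s ∈ Ioo 0 R, 0 ≤ J s)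
    (hh : ∀ t : ℂ, 0 < ‖t‖ → ‖t‖ < R → ContDiffAt ℝ 2 h t)
    (hlap : ∀ t : ℂ, 0 < ‖t‖ → ‖t‖ < R → ‖Δ h t‖ ≤ K ‖t‖)
    (hbdd : ∀ t : ℂ, ‖t‖ ≤ r → ‖h t‖ ≤ M) (hsph : ∀ t : ℂ, ‖t‖ = r → ‖h t‖ ≤ δ)
    {t : ℂ} (ht : 0 < ‖t‖) (htr : ‖t‖ ≤ r) :
    ‖h t‖ ≤ δ + ∫ s in ‖t‖..r, J s / s := by
  have hcont : ContinuousOn (fun s => J s / s) (Ioo 0 R) :=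
    ContinuousOn.div (fun s hs => (hJ s hs).continuousAt.continuousWithinAt) continuousOn_id
      fun s hs => hs.1.ne'
  set w₀ : ℝ → ℝ := fun ρ => ∫ s in r..ρ, J s / s with hw₀
  have hw₀d (s : ℝ) (hs : s ∈ Ioo 0 R) : HasDerivAt w₀ (J s / s) s :=
    intervalIntegral.integral_hasDerivAt_right
      (hcont.mono (OrdConnected.uIcc_subset inferInstance hr hs)).intervalIntegrable
      (hcont.stronglyMeasurableAtFilter isOpen_Ioo s hs)
      (hcont.continuousAt (isOpen_Ioo.mem_nhds hs))
  have hw₀neg (ρ : ℝ) (hρ : 0 < ρ) (hρr : ρ ≤ r) : w₀ ρ ≤ 0 := by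
    rw [hw₀]
    dsimp only
    rw [intervalIntegral.integral_symm, neg_nonpos]
    exact intervalIntegral.integral_nonneg hρr fun s hs =>
      div_nonneg (hJ0 s ⟨hρ.trans_le hs.1, hs.2.trans_lt hr.2⟩) (hρ.trans_le hs.1).le
  have hmain (ε : ℝ) (hε : 0 < ε) :
      ‖h t‖ ≤ δ - (w₀ ‖t‖ + ε * (Real.log ‖t‖ - Real.log r + (‖t‖ - r))) := by
    refine norm_le_sub_radial_of_laplacian_lt (R := R) (r := r) (M := M)
      (w := fun ρ => w₀ ρ + ε * (Real.log ρ - Real.log r + (ρ - r)))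
      (g := fun s => J s + ε * (1 + s)) (k := fun s => s ^ 2 * K s + ε * s) hr.2 ?_ ?_ hh ?_ hbdd
      hsph ?_ ?_ ht htr
    · intro s hs hsR
      refine ((hw₀d s ⟨hs, hsR⟩).add ((((Real.hasDerivAt_log hs.ne').sub_const _).add
        ((hasDerivAt_id s).sub_const r)).const_mul ε)).congr_deriv ?_
      field_simp
    · intro s hs hsR
      refine ((hJ s ⟨hs, hsR⟩).add (((hasDerivAt_id s).const_add 1).const_mul ε)).congr_deriv ?_
      field_simp
    · intro z hz hzR
      refine (hlap z hz hzR).trans_lt ?_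
      rw [lt_div_iff₀ (by positivity)]
      nlinarith [mul_pos hε hz]
    · simp [hw₀]
    · have hlog : Tendsto (fun ρ => ε * Real.log ρ + (-ε * Real.log r)) (𝓝[>] 0) atBot :=
        tendsto_atBot_add_const_right _ _ (Real.tendsto_log_nhdsGT_zero.const_mul_atBot hε)
      refine tendsto_atBot_mono' _ ?_ hlog
      filter_upwards [self_mem_nhdsWithin, nhdsWithin_le_nhds (eventually_lt_nhds hr.1)]
        with ρ hρ hρr
      have := hw₀neg ρ hρ hρr.le
      nlinarith [mul_pos hε (sub_pos.2 hρr)]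
  have hlim : Tendsto
      (fun ε : ℝ => δ - (w₀ ‖t‖ + ε * (Real.log ‖t‖ - Real.log r + (‖t‖ - r))))
      (𝓝[>] 0) (𝓝 (δ - w₀ ‖t‖)) := by
    have : Continuous
      fun ε : ℝ => δ - (w₀ ‖t‖ + ε * (Real.log ‖t‖ - Real.log r + (‖t‖ - r))) := by fun_prop
    simpa using (this.tendsto 0).mono_left nhdsWithin_le_nhds
  have hle := ge_of_tendsto hlim (by
    filter_upwards [self_mem_nhdsWithin] with ε hε using hmain ε hε)
  rw [intervalIntegral.integral_symm]
  linarith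

theorem exists_tendsto_of_forall_exists_norm_sub_le {f : ℂ → ℂ}
    (hf : ∀ η > 0, ∃ H : ℂ → ℂ, ContinuousAt H 0 ∧ ∀ᶠ t in 𝓝[≠] (0 : ℂ), ‖f t - H t‖ ≤ η) :
    ∃ L : ℂ, Tendsto f (𝓝[≠] 0) (𝓝 L) := by
  rw [← cauchy_map_iff_exists_tendsto, Metric.cauchy_iff]
  refine ⟨inferInstance, fun ε hε => ?_⟩
  obtain ⟨H, hH, hfH⟩ := hf (ε / 5) (by positivity)
  have hH' : ∀ᶠ t in 𝓝[≠] (0 : ℂ), dist (H t) (H 0) < ε / 5 :=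
    nhdsWithin_le_nhds (Metric.tendsto_nhds.1 hH (ε / 5) (by positivity))
  have hev : ∀ᶠ t in 𝓝[≠] (0 : ℂ), dist (f t) (H 0) ≤ 2 * (ε / 5) := by
    filter_upwards [hfH, hH'] with t h1 h2
    rw [← dist_eq_norm] at h1
    linarith [dist_triangle (f t) (H t) (H 0)]
  refine ⟨Metric.closedBall (H 0) (2 * (ε / 5)), hev, fun x hx y hy => ?_⟩
  rw [Metric.mem_closedBall] at hx hy
  linarith [dist_triangle_right x y (H 0)]

/-- A bounded `C²` function on a punctured disc whose Laplacian satisfies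
`|Δf(t)| ≤ C κ(|t|)/|t|²` with `∫₀^{r₀} (∑ₙ κ(2⁻ⁿ s)) ds/s < ∞` admits a
limit at the origin. -/
theorem punctured_disc_limit_of_laplacian_kappa_bound
    (r₀ : ℝ) (hr₀ : 0 < r₀) (κ : ℝ → ℝ) (C : ℝ) (hC : 0 < C)
    (hκ_meas : Measurable κ) (hκ_nonneg : ∀ s : ℝ, 0 < s → 0 ≤ κ s)
    (hκ_int : ∫⁻ s in Ioo (0:ℝ) r₀,
        (∑' n : ℕ, ENNReal.ofReal (κ ((2:ℝ)⁻¹ ^ n * s)))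
          * ENNReal.ofReal (1 / s) < ⊤)
    (f : ℂ → ℂ) (hbdd : ∃ M : ℝ, ∀ t : ℂ, ‖f t‖ ≤ M)
    (hf : ContDiffOn ℝ 2 f {t : ℂ | 0 < ‖t‖ ∧ ‖t‖ < r₀})
    (hbound : ∀ t : ℂ, 0 < ‖t‖ → ‖t‖ < r₀ →
      ‖fderiv ℝ (fun s => fderiv ℝ f s 1) t 1
        + fderiv ℝ (fun s => fderiv ℝ f s Complex.I) t Complex.I‖
        ≤ C * κ ‖t‖ / ‖t‖ ^ 2) :
    ∃ L : ℂ, Tendsto f (nhdsWithin 0 {(0:ℂ)}ᶜ) (nhds L) := by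
  have hopen : IsOpen {t : ℂ | 0 < ‖t‖ ∧ ‖t‖ < r₀} :=
    (isOpen_lt continuous_const continuous_norm).inter
      (isOpen_lt continuous_norm continuous_const)
  have hfat (t : ℂ) (ht : 0 < ‖t‖) (htr : ‖t‖ < r₀) : ContDiffAt ℝ 2 f t :=
    hf.contDiffAt (hopen.mem_nhds ⟨ht, htr⟩)
  obtain ⟨K, hKcont, hK, hKatt⟩ :=
    exists_continuousOn_radial_majorant_s7 (continuousOn_laplacian_of_contDiffOn hopen hf)
  have hK0 (s : ℝ) (hs : s ∈ Ioo 0 r₀) : 0 ≤ K s := by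
    obtain ⟨t, -, h⟩ := hKatt s hs
    rw [h]
    positivity
  have hKκ (s : ℝ) (hs : s ∈ Ioo 0 r₀) : s * K s ≤ C * (κ s / s) := by
    obtain ⟨t, rfl, h⟩ := hKatt s hs
    rw [h, (hfat t hs.1 hs.2).laplacian_eq_fderiv_fderiv]
    refine (mul_le_mul_of_nonneg_left (hbound t hs.1 hs.2) hs.1.le).trans_eq ?_
    have := hs.1.ne'
    field_simp
  obtain ⟨hκint, hκsum⟩ := summable_integral_dyadic hr₀ hκ_meas hκ_nonneg hκ_int
  have hsKcont : ContinuousOn (fun s => s * K s) (Ioo 0 r₀) := continuousOn_id.mul hKcont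
  have hsKint : IntegrableOn (fun s => s * K s) (Ioo 0 r₀) := by
    refine (hκint.const_mul C).mono' (hsKcont.aestronglyMeasurable measurableSet_Ioo) ?_
    filter_upwards [ae_restrict_mem measurableSet_Ioo] with s hs
    rw [Real.norm_of_nonneg (mul_nonneg hs.1.le (hK0 s hs))]
    exact hKκ s hs
  have hii {F : ℝ → ℝ} (hF : IntegrableOn F (Ioo 0 r₀)) {x : ℝ} (hx0 : 0 ≤ x) (hx : x ≤ r₀) :
      IntervalIntegrable F volume 0 x := by
    rw [intervalIntegrable_iff_integrableOn_Ioo_of_le hx0]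
    exact hF.mono_set (Ioo_subset_Ioo_right hx)
  set J : ℝ → ℝ := fun x => ∫ s in 0..x, s * K s
  have hJ (s : ℝ) (hs : s ∈ Ioo 0 r₀) : HasDerivAt J (s * K s) s :=
    intervalIntegral.integral_hasDerivAt_right (hii hsKint hs.1.le hs.2.le)
      (hsKcont.stronglyMeasurableAtFilter isOpen_Ioo s hs)
      (hsKcont.continuousAt (isOpen_Ioo.mem_nhds hs))
  have hJ0 (s : ℝ) (hs : s ∈ Ioo 0 r₀) : 0 ≤ J s := by
    refine intervalIntegral.integral_nonneg hs.1.le fun x hx => ?_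
    rcases hx.1.eq_or_lt with rfl | hx0
    · simp
    · exact mul_nonneg hx0.le (hK0 x ⟨hx0, hx.2.trans_lt hs.2⟩)
  set a : ℕ → ℝ := fun n => C * ∫ s in 0..(2:ℝ)⁻¹ ^ n * r₀, κ s / s
  have ha : Summable a := hκsum.mul_left C
  have hκs {x : ℝ} (hx : 0 ≤ x) : 0 ≤ κ x / x := by
    rcases hx.eq_or_lt with rfl | hx0
    · simp
    · exact div_nonneg (hκ_nonneg x hx0) hx0.le
  have ha0 (n : ℕ) : 0 ≤ a n :=
    mul_nonneg hC.le (intervalIntegral.integral_nonneg (by positivity) fun x hx => hκs hx.1)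
  have hxle (n : ℕ) : (2:ℝ)⁻¹ ^ n * r₀ ≤ r₀ :=
    mul_le_of_le_one_left hr₀.le (pow_le_one₀ (by norm_num) (by norm_num))
  have hJa (n : ℕ) (s : ℝ) (hs : s ∈ Ioo 0 r₀) (hsn : s ≤ (2:ℝ)⁻¹ ^ n * r₀) : J s ≤ a n := by
    calc J s ≤ ∫ x in 0..s, C * (κ x / x) := by
          refine intervalIntegral.integral_mono_on_of_le_Ioo hs.1.le
            (hii hsKint hs.1.le hs.2.le) ((hii hκint hs.1.le hs.2.le).const_mul C)
            fun x hx => hKκ x ⟨hx.1, hx.2.trans hs.2⟩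
      _ = C * ∫ x in 0..s, κ x / x := intervalIntegral.integral_const_mul _ _
      _ ≤ a n := by
          refine mul_le_mul_of_nonneg_left ?_ hC.le
          refine intervalIntegral.integral_mono_interval le_rfl hs.1.le hsn ?_
            (hii hκint (hs.1.le.trans hsn) (hxle n))
          filter_upwards [ae_restrict_mem measurableSet_Ioc] with x hx using hκs hx.1.le
  obtain ⟨M, hM⟩ := hbdd
  refine exists_tendsto_of_forall_exists_norm_sub_le fun η hη => ?_
  obtain ⟨N, hNη, hN⟩ : ∃ N : ℕ, ∑' n, a (n + N) < η / 2 ∧ 0 < N :=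
    (((tendsto_sum_nat_add a).eventually (eventually_lt_nhds (half_pos hη))).and
      (eventually_gt_atTop 0)).exists
  set r : ℝ := (2:ℝ)⁻¹ ^ N * r₀ with hrdef
  have hr : r ∈ Ioo 0 r₀ :=
    ⟨by positivity, mul_lt_of_lt_one_left hr₀ (pow_lt_one₀ (by norm_num) (by norm_num) hN.ne')⟩
  have hfsph : ContinuousOn f (Metric.sphere 0 r) := hf.continuousOn.mono fun t ht => by
    rw [mem_sphere_zero_iff_norm] at ht
    rw [mem_ofPred_eq, ht]
    exact hr
  obtain ⟨H, hH, hfH⟩ := exists_harmonicOnNhd_norm_sub_le_on_sphere hr.1 (half_pos hη) hfsph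
  have hHcont : Continuous H := continuousOn_univ.1 hH.continuousOn
  obtain ⟨M', hM'⟩ := (isCompact_closedBall (0 : ℂ) r).exists_bound_of_continuousOn
    hHcont.continuousOn
  refine ⟨H, hHcont.continuousAt, ?_⟩
  have hnear : ∀ᶠ t : ℂ in 𝓝[≠] 0, ‖t‖ < r :=
    nhdsWithin_le_nhds (continuous_norm.continuousAt.eventually_lt_const (by simpa using hr.1))
  filter_upwards [hnear, self_mem_nhdsWithin] with t htr ht
  have ht0 : 0 < ‖t‖ := norm_pos_iff.2 ht
  have hest := norm_le_add_integral_of_norm_laplacian_le (h := f - H) (M := M + M') hr hJ hJ0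
    (fun z hz hzr => (hfat z hz hzr).sub (hH z (mem_univ z)).1)
    (fun z hz hzr => by
      rw [(hfat z hz hzr).laplacian_sub (hH z (mem_univ z)).1,
        (hH z (mem_univ z)).2.self_of_nhds, Pi.zero_apply, sub_zero]
      exact hK z hz hzr)
    (fun z hz => (norm_sub_le _ _).trans (add_le_add (hM z) (hM' z (by simpa using hz))))
    hfH ht0 htr.le
  have htail := intervalIntegral_div_le_tsum_of_dyadic hr₀
    (fun s hs => (hJ s hs).continuousAt.continuousWithinAt) hJ0 hJa ha ha0 hN ht0 htr.le
  rw [← hrdef] at htail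
  rw [Pi.sub_apply] at hest
  linarith
end

section
/- Let r₀ > 0 and let κ : (0, ∞) → [0, ∞) be a measurable function such that ∫₀^{r₀} √(κ(s)) · (1/s) ds < ∞. Let C > 0 and let f : ℂ → ℂ be continuously differentiable (in the real sense) on the punctured disc D* = {t ∈ ℂ : 0 < |t| < r₀}, and suppose ‖Df(t)‖ ≤ C · √(κ(|t|)) / |t| for every t ∈ D*, where Df(t) denotes the real Fréchet derivative of f at t. Then f admits a finite limit at the origin: there exists L ∈ ℂ such that f(t) → L as t → 0 with t ≠ 0. -/
open MeasureTheory Set Filter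

/-- Along a ray, the variation of `f` is at most the integral of a radial bound for its
derivative. -/
lemma norm_sub_le_integral_of_norm_fderiv_le_radial {E F : Type*}
    [NormedAddCommGroup E] [NormedSpace ℝ E] [NormedAddCommGroup F] [NormedSpace ℝ F]
    {f : E → F} {g : ℝ → ℝ} {w : E} (hw : ‖w‖ = 1) {a b : ℝ} (ha : 0 < a) (hab : a ≤ b)
    (hf : ∀ t, ‖t‖ ∈ Icc a b → DifferentiableAt ℝ f t)
    (hg : ∀ t, ‖t‖ ∈ Icc a b → ‖fderiv ℝ f t‖ ≤ g ‖t‖)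
    (hint : IntervalIntegrable g volume a b) :
    ‖f (b • w) - f (a • w)‖ ≤ ∫ s in a..b, g s := by
  have hnorm : ∀ x ∈ Icc a b, ‖x • w‖ = x := fun x hx ↦ by
    rw [norm_smul, hw, mul_one, Real.norm_of_nonneg (ha.le.trans hx.1)]
  have hderiv : ∀ x ∈ Icc a b,
      HasDerivAt (fun y : ℝ ↦ f (y • w)) (fderiv ℝ f (x • w) w) x := fun x hx ↦ by
    have h := (hf (x • w) (by rwa [hnorm x hx])).hasFDerivAt.comp_hasDerivAt x
      ((hasDerivAt_id x).smul_const w)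
    simpa [Function.comp_def] using h
  refine norm_sub_le_integral_of_norm_deriv_le_of_le (f := fun y : ℝ ↦ f (y • w)) hab
    (fun x hx ↦ (hderiv x hx).continuousAt.continuousWithinAt)
    (fun x hx ↦ (hderiv x (Ioo_subset_Icc_self hx)).differentiableAt.differentiableWithinAt)
    (.of_forall fun x hx ↦ ?_) hint
  have hx' := Ioo_subset_Icc_self hx
  rw [(hderiv x hx').deriv]
  calc ‖fderiv ℝ f (x • w) w‖ ≤ ‖fderiv ℝ f (x • w)‖ * ‖w‖ := ContinuousLinearMap.le_opNorm _ _
    _ ≤ g x := by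
      have h := hg (x • w) (by rwa [hnorm x hx'])
      rwa [hnorm x hx', ← mul_one ‖fderiv ℝ f (x • w)‖, ← hw] at h

/-- On a circle of radius `s`, the oscillation of `f` is at most `2πs` times a bound for its
derivative. -/
lemma norm_circleMap_sub_le_of_norm_fderiv_le {F : Type*} [NormedAddCommGroup F] [NormedSpace ℝ F]
    {f : ℂ → F} {s M : ℝ} (hs : 0 < s)
    (hf : ∀ t : ℂ, ‖t‖ = s → DifferentiableAt ℝ f t)
    (hM : ∀ t : ℂ, ‖t‖ = s → ‖fderiv ℝ f t‖ ≤ M) {θ₁ θ₂ : ℝ} (hθ : |θ₁ - θ₂| ≤ 2 * Real.pi) :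
    ‖f (circleMap 0 s θ₁) - f (circleMap 0 s θ₂)‖ ≤ 2 * Real.pi * (s * M) := by
  have hnorm : ∀ θ, ‖circleMap 0 s θ‖ = s := fun θ ↦ by simp [abs_of_pos hs]
  have hM0 : 0 ≤ M := (norm_nonneg _).trans (hM _ (hnorm 0))
  have h := convex_univ.norm_image_sub_le_of_norm_hasDerivWithin_le
    (f := fun θ ↦ f (circleMap 0 s θ)) (C := M * s) (x := θ₂) (y := θ₁)
    (fun θ _ ↦ ((hf _ (hnorm θ)).hasFDerivAt.comp_hasDerivAt θ
      (hasDerivAt_circleMap 0 s θ)).hasDerivWithinAt)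
    (fun θ _ ↦ (ContinuousLinearMap.le_opNorm _ _).trans
      (mul_le_mul (hM _ (hnorm θ)) (by simp [abs_of_pos hs]) (norm_nonneg _) hM0))
    (mem_univ _) (mem_univ _)
  calc _ ≤ M * s * ‖θ₁ - θ₂‖ := h
    _ ≤ M * s * (2 * Real.pi) := by rw [Real.norm_eq_abs]; gcongr
    _ = _ := by ring

/-- Since `1/s` is not integrable at `0`, an integrable `g` satisfies `s * g s ≤ ε` for some
arbitrarily small `s`. -/
lemma exists_mul_le_of_integrableOn_Ioo {g : ℝ → ℝ} {δ ε : ℝ} (hδ : 0 < δ) (hε : 0 < ε)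
    (hg : IntegrableOn g (Ioo 0 δ)) : ∃ s ∈ Ioo 0 δ, s * g s ≤ ε := by
  by_contra! h
  have hinv : IntegrableOn (fun s : ℝ ↦ s⁻¹) (Ioo 0 δ) := by
    refine (hg.div_const ε).mono' measurable_inv.aestronglyMeasurable
      ((ae_restrict_mem measurableSet_Ioo).mono fun s hs ↦ ?_)
    rw [Real.norm_of_nonneg (inv_nonneg.2 hs.1.le), le_div_iff₀ hε, inv_mul_le_iff₀ hs.1]
    exact (h s hs).le
  rw [← intervalIntegrable_iff_integrableOn_Ioo_of_le hδ.le] at hinv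
  simp [intervalIntegrable_inv_iff, hδ.ne] at hinv

/-- A function on a punctured disc whose derivative has an integrable radial bound has a limit at
the centre. -/
theorem exists_tendsto_nhdsNE_zero_of_norm_fderiv_le {F : Type*} [NormedAddCommGroup F]
    [NormedSpace ℝ F] [CompleteSpace F] {f : ℂ → F} {g : ℝ → ℝ} {r : ℝ} (hr : 0 < r)
    (hint : IntegrableOn g (Ioo 0 r))
    (hf : ∀ t : ℂ, ‖t‖ ∈ Ioo 0 r → DifferentiableAt ℝ f t)
    (hg : ∀ t : ℂ, ‖t‖ ∈ Ioo 0 r → ‖fderiv ℝ f t‖ ≤ g ‖t‖) :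
    ∃ L, Tendsto f (nhdsWithin 0 {(0 : ℂ)}ᶜ) (nhds L) := by
  have hii : IntervalIntegrable g volume 0 r :=
    (intervalIntegrable_iff_integrableOn_Ioo_of_le hr.le).2 hint
  set G : ℝ → ℝ := fun x ↦ ∫ s in 0..x, g s
  have hsub : ∀ x ∈ Ioo 0 r, IntervalIntegrable g volume 0 x := fun x hx ↦
    hii.mono_set (by rw [uIcc_of_le hx.1.le, uIcc_of_le hr.le]; exact Icc_subset_Icc_right hx.2.le)
  have hle : ∀ w : ℂ, ‖w‖ = 1 → ∀ a ∈ Ioo 0 r, ∀ b ∈ Ioo 0 r, a ≤ b →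
      ‖f (b • w) - f (a • w)‖ ≤ |G b - G a| := by
    intro w hw a ha b hb hab
    have hmem : Icc a b ⊆ Ioo 0 r := fun x hx ↦ ⟨ha.1.trans_le hx.1, hx.2.trans_lt hb.2⟩
    refine (norm_sub_le_integral_of_norm_fderiv_le_radial hw ha.1 hab
      (fun t ht ↦ hf t (hmem ht)) (fun t ht ↦ hg t (hmem ht))
      ((hsub a ha).symm.trans (hsub b hb))).trans ?_
    rw [← intervalIntegral.integral_interval_sub_left (hsub b hb) (hsub a ha)]
    exact le_abs_self _
  have hray : ∀ w : ℂ, ‖w‖ = 1 → ∀ a ∈ Ioo 0 r, ∀ b ∈ Ioo 0 r,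
      ‖f (b • w) - f (a • w)‖ ≤ |G b| + |G a| := by
    intro w hw a ha b hb
    refine le_trans ?_ (abs_sub (G b) (G a))
    rcases le_total a b with hab | hab
    · exact hle w hw a ha b hb hab
    · rw [norm_sub_rev, abs_sub_comm]
      exact hle w hw b hb a ha hab
  have hG : Tendsto G (nhdsWithin 0 (Ioi 0)) (nhds 0) := by
    have hc := intervalIntegral.continuousOn_primitive_interval' hii left_mem_uIcc 0 left_mem_uIcc
    rw [uIcc_of_le hr.le] at hc
    have h0 := (hc.mono Ioc_subset_Icc_self).tendsto
    rwa [nhdsWithin_Ioc_eq_nhdsGT hr, intervalIntegral.integral_same] at h0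
  rw [← cauchy_map_iff_exists_tendsto, Metric.cauchy_iff]
  refine ⟨inferInstance, fun ε hε ↦ ?_⟩
  obtain ⟨δ, hδ, hδG⟩ := mem_nhdsGT_iff_exists_Ioo_subset.1
    (hG (Metric.ball_mem_nhds 0 (show 0 < ε / 5 by positivity)))
  set η := min δ r
  have hη : 0 < η := lt_min hδ hr
  have hηr : ∀ x ∈ Ioo 0 η, x ∈ Ioo 0 r := fun x hx ↦ ⟨hx.1, hx.2.trans_le (min_le_right _ _)⟩
  have hGη : ∀ x ∈ Ioo 0 η, |G x| < ε / 5 := fun x hx ↦ by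
    simpa using hδG ⟨hx.1, hx.2.trans_le (min_le_left _ _)⟩
  obtain ⟨s, hs, hsg⟩ := exists_mul_le_of_integrableOn_Ioo hη
    (show 0 < ε / 5 / (2 * Real.pi) by positivity) (hint.mono_set hηr)
  refine ⟨_, image_mem_map (inter_mem_nhdsWithin _ (Metric.ball_mem_nhds 0 hη)), ?_⟩
  have hdist : ∀ t ∈ {(0 : ℂ)}ᶜ ∩ Metric.ball 0 η,
      ‖f t - f (circleMap 0 s t.arg)‖ < 2 * (ε / 5) := by
    rintro t ⟨ht0, htη⟩
    have ht : ‖t‖ ∈ Ioo 0 η := ⟨norm_pos_iff.2 ht0, by simpa using htη⟩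
    have h := hray (Complex.exp (t.arg * Complex.I)) (Complex.norm_exp_ofReal_mul_I _)
      s (hηr s hs) ‖t‖ (hηr _ ht)
    rw [Complex.real_smul, Complex.real_smul, Complex.norm_mul_exp_arg_mul_I] at h
    rw [circleMap_zero]
    linarith [hGη s hs, hGη _ ht]
  rintro _ ⟨t, ht, rfl⟩ _ ⟨u, hu, rfl⟩
  have harg : |t.arg - u.arg| ≤ 2 * Real.pi := by
    refine (abs_sub _ _).trans ?_
    linarith [Complex.abs_arg_le_pi t, Complex.abs_arg_le_pi u]
  have hcirc := norm_circleMap_sub_le_of_norm_fderiv_le (f := f) (M := g s) hs.1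
    (fun z hz ↦ hf z (hz ▸ hηr s hs)) (fun z hz ↦ hz ▸ hg z (hz ▸ hηr s hs)) harg
  rw [le_div_iff₀' (by positivity)] at hsg
  have hu' := hdist u hu
  rw [norm_sub_rev] at hu'
  rw [dist_eq_norm]
  linarith [hdist t ht, norm_sub_le_norm_sub_add_norm_sub (f t) (f (circleMap 0 s t.arg)) (f u),
    norm_sub_le_norm_sub_add_norm_sub (f (circleMap 0 s t.arg)) (f (circleMap 0 s u.arg)) (f u)]

/-- A `C¹` function on a punctured disc whose real Fréchet derivative satisfies
`‖Df(t)‖ ≤ C √(κ(|t|))/|t|` with `∫₀^{r₀} √(κ(s)) ds/s < ∞` admits a limit at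
the origin. -/
theorem punctured_disc_limit_of_sqrt_kappa_deriv_bound
    (r₀ : ℝ) (hr₀ : 0 < r₀) (κ : ℝ → ℝ) (C : ℝ) (hC : 0 < C)
    (hκ_meas : Measurable κ) (hκ_nonneg : ∀ s : ℝ, 0 < s → 0 ≤ κ s)
    (hκ_int : IntegrableOn (fun s => Real.sqrt (κ s) / s) (Ioo (0:ℝ) r₀))
    (f : ℂ → ℂ)
    (hf : ContDiffOn ℝ 1 f {t : ℂ | 0 < ‖t‖ ∧ ‖t‖ < r₀})
    (hbound : ∀ t : ℂ, 0 < ‖t‖ → ‖t‖ < r₀ →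
      ‖fderiv ℝ f t‖ ≤ C * Real.sqrt (κ ‖t‖) / ‖t‖) :
    ∃ L : ℂ, Tendsto f (nhdsWithin 0 {(0:ℂ)}ᶜ) (nhds L) := by
  have hopen : IsOpen {t : ℂ | 0 < ‖t‖ ∧ ‖t‖ < r₀} :=
    (isOpen_lt continuous_const continuous_norm).inter (isOpen_lt continuous_norm continuous_const)
  refine exists_tendsto_nhdsNE_zero_of_norm_fderiv_le (g := fun s ↦ C * (√(κ s) / s)) hr₀
    (hκ_int.const_mul C)
    (fun t ht ↦ (hf.differentiableOn one_ne_zero).differentiableAt (hopen.mem_nhds ht))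
    fun t ht ↦ ?_
  simpa only [mul_div_assoc] using hbound t ht.1 ht.2
end
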